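/- arXiv:1812.05837 — 4 statements merged into one kernel-verified Lean document; each statement's English description precedes it below -/
import Mathlib

section
/- Let d ≥ 1. Smooth functions ξ : ℝ × ℝ^d → ℝ^d and f : ℝ × ℝ^d → ℝ form a Lie point symmetry of the free equation d²x/dt² = 0 — i.e., for every affine curve x(t) = x₀ + t w (x₀, w ∈ ℝ^d) the curve t ↦ ξ(t, x(t)) − w·f(t, x(t)) (scalar f times vector w) has identically vanishing second derivative — if and only if there exist constants α₀, α₁, α₂ ∈ ℝ, vectors a₀, b₀, β₀, β₁ ∈ ℝ^d and a d×d real matrix A such that for all (t,x): f(t,x) = α₀ + α₁ t + α₂ t² + (β₀ + t β₁)·x and ξ(t,x) = a₀ + A x + (β₁·x) x + t (b₀ + α₂ x). In particular the space of such symmetries has dimension (d+1)(d+3). -/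
open scoped RealInnerProductSpace

/-- A continuous map satisfying Jensen's functional equation is affine. -/
theorem exists_affine_of_jensen {E F : Type*} [NormedAddCommGroup E] [NormedSpace ℝ E]
    [NormedAddCommGroup F] [NormedSpace ℝ F] {g : E → F} (hg : Continuous g)
    (h : ∀ x v, g (x + v) + g (x - v) = (2 : ℝ) • g x) :
    ∃ L : E →L[ℝ] F, ∀ x, g x = g 0 + L x := by
  have hdouble : ∀ x, g ((2 : ℝ) • x) + g 0 = (2 : ℝ) • g x := fun x => by
    have := h x x
    rwa [sub_self, ← two_smul ℝ x] at this
  have hadd : ∀ a b, g (a + b) - g 0 = (g a - g 0) + (g b - g 0) := fun a b => by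
    have h1 := h ((1 / 2 : ℝ) • (a + b)) ((1 / 2 : ℝ) • (a - b))
    have h2 := hdouble ((1 / 2 : ℝ) • (a + b))
    rw [show (1 / 2 : ℝ) • (a + b) + (1 / 2 : ℝ) • (a - b) = a by module,
      show (1 / 2 : ℝ) • (a + b) - (1 / 2 : ℝ) • (a - b) = b by module] at h1
    rw [smul_smul, show (2 : ℝ) * (1 / 2) = 1 by norm_num, one_smul, ← h1] at h2
    rw [eq_sub_of_add_eq h2]
    abel
  let k : E →+ F := AddMonoidHom.mk' (fun x => g x - g 0) hadd
  refine ⟨k.toRealLinearMap (hg.sub continuous_const), fun x => ?_⟩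
  change g x = g 0 + (g x - g 0)
  abel

/-- A continuous function of a real variable whose second differences are `h ^ 2 * K` is a
quadratic polynomial. -/
theorem eq_quadratic_of_second_difference {g : ℝ → ℝ} (hg : Continuous g) {K : ℝ}
    (h : ∀ t h, g (t + h) + g (t - h) - 2 * g t = h ^ 2 * K) (t : ℝ) :
    g t = g 0 + t * ((g 1 - g (-1)) / 2) + t ^ 2 * ((g 1 + g (-1) - 2 * g 0) / 2) := by
  obtain ⟨L, hL⟩ := exists_affine_of_jensen (g := fun t => g t - t ^ 2 * (K / 2))
    (by fun_prop) (fun t s => by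
      have := h t s
      simp only [smul_eq_mul]
      linear_combination this)
  have hL' : ∀ t, L t = t * L 1 := fun t => by
    rw [← smul_eq_mul, ← map_smul, smul_eq_mul, mul_one]
  have h0 := hL t
  have h1 := hL 1
  have h2 := hL (-1)
  rw [hL'] at h0 h2
  linear_combination h0 - t * (h1 - h2) / 2 - t ^ 2 / 2 * (h1 + h2)

/-- A smooth curve with vanishing second derivative has vanishing second differences. -/
theorem second_difference_eq_zero_of_iteratedDeriv_two {F : Type*} [NormedAddCommGroup F]
    [NormedSpace ℝ F] {g : ℝ → F} (hg : ContDiff ℝ 2 g) (h : ∀ t, iteratedDeriv 2 g t = 0)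
    (t s : ℝ) : g (t + s) + g (t - s) - (2 : ℝ) • g t = 0 := by
  have hd : Differentiable ℝ g := hg.differentiable (by norm_num)
  have hd' : Differentiable ℝ (deriv g) := by
    have := hg.differentiable_iteratedDeriv 1 (by norm_num)
    rwa [iteratedDeriv_one] at this
  have hconst : ∀ u, deriv g u = deriv g 0 := fun u =>
    is_const_of_deriv_eq_zero hd' (fun u => by
      simpa [iteratedDeriv_succ, iteratedDeriv_zero] using h u) u 0
  have haff : ∀ u, g u - u • deriv g 0 = g 0 := fun u => by
    have hD : ∀ y, HasDerivAt (fun u => g u - u • deriv g 0) 0 y := fun y => by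
      have := (hd y).hasDerivAt.sub ((hasDerivAt_id y).smul_const (deriv g 0))
      rw [hconst y, one_smul, sub_self] at this
      exact this
    have := is_const_of_deriv_eq_zero (fun y => (hD y).differentiableAt)
      (fun y => (hD y).deriv) u 0
    simpa using this
  rw [eq_add_of_sub_eq (haff (t + s)), eq_add_of_sub_eq (haff (t - s)),
    eq_add_of_sub_eq (haff t)]
  module

section FreeMotion

variable {E : Type*} [NormedAddCommGroup E] [InnerProductSpace ℝ E]

/-- The symmetry condition, integrated to a second difference identity valid in every direction
`(h, v)` of space-time, including the purely spatial directions. -/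
theorem free_motion_second_difference {ξ : ℝ × E → E} {f : ℝ × E → ℝ}
    (hξ : ContDiff ℝ 2 ξ) (hf : ContDiff ℝ 2 f)
    (H : ∀ x₀ w : E, ∀ t : ℝ,
      iteratedDeriv 2 (fun s => ξ (s, x₀ + s • w) - f (s, x₀ + s • w) • w) t = 0)
    (t h : ℝ) (x v : E) :
    h • (ξ (t + h, x + v) + ξ (t - h, x - v) - (2 : ℝ) • ξ (t, x)) =
      (f (t + h, x + v) + f (t - h, x - v) - 2 * f (t, x)) • v := by
  have hξc := hξ.continuous
  have hfc := hf.continuous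
  have hl : Continuous fun h : ℝ =>
      h • (ξ (t + h, x + v) + ξ (t - h, x - v) - (2 : ℝ) • ξ (t, x)) := by fun_prop
  have hr : Continuous fun h : ℝ =>
      (f (t + h, x + v) + f (t - h, x - v) - 2 * f (t, x)) • v := by fun_prop
  refine congrFun (Continuous.ext_on (dense_compl_singleton (0 : ℝ)) hl hr fun h hh => ?_) h
  have hh : h ≠ 0 := hh
  have key := second_difference_eq_zero_of_iteratedDeriv_two (by fun_prop)
    (H (x - t • h⁻¹ • v) (h⁻¹ • v)) t h
  have hv : h • h⁻¹ • v = v := smul_inv_smul₀ hh v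
  have e1 : x - t • h⁻¹ • v + (t + h) • h⁻¹ • v = x + v := by rw [add_smul, hv]; abel
  have e2 : x - t • h⁻¹ • v + (t - h) • h⁻¹ • v = x - v := by rw [sub_smul, hv]; abel
  have e3 : x - t • h⁻¹ • v + t • h⁻¹ • v = x := by abel
  simp only [e1, e2, e3] at key
  generalize h⁻¹ • v = w at key hv
  subst hv
  rw [← sub_eq_zero]
  linear_combination (norm := module) h • key

/-- Continuous solutions of the second difference identity are quadratic. -/
theorem exists_coefficients_of_second_difference [CompleteSpace E] [Nontrivial E]
    {ξ : ℝ × E → E} {f : ℝ × E → ℝ} (hξ : Continuous ξ) (hf : Continuous f)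
    (H : ∀ (t h : ℝ) (x v : E),
      h • (ξ (t + h, x + v) + ξ (t - h, x - v) - (2 : ℝ) • ξ (t, x)) =
        (f (t + h, x + v) + f (t - h, x - v) - 2 * f (t, x)) • v) :
    ∃ (α₀ α₁ α₂ : ℝ) (a₀ b₀ β₀ β₁ : E) (A : E →ₗ[ℝ] E), ∀ (t : ℝ) (x : E),
      f (t, x) = α₀ + α₁ * t + α₂ * t ^ 2 + ⟪β₀ + t • β₁, x⟫ ∧
      ξ (t, x) = a₀ + A x + ⟪β₁, x⟫ • x + t • (b₀ + α₂ • x) := by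
  obtain ⟨e, he⟩ := exists_ne (0 : E)
  have hfx : ∀ t, ∃ L : E →L[ℝ] ℝ, ∀ x, f (t, x) = f (t, 0) + L x := fun t =>
    exists_affine_of_jensen (g := fun x => f (t, x)) (by fun_prop) fun x v => by
      by_cases hv : v = 0
      · subst hv
        simp only [add_zero, sub_zero, smul_eq_mul]
        ring
      · have := H t 0 x v
        rw [zero_smul, eq_comm, smul_eq_zero, or_iff_left hv] at this
        simp only [add_zero, sub_zero] at this
        simp only [smul_eq_mul]
        linarith
  choose L hL using hfx
  obtain ⟨p, q, hp, hpq⟩ : ∃ p q : E → E, Continuous p ∧ ∀ t x, ξ (t, x) = p x + t • q x := by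
    refine ⟨fun x => ξ (0, x), fun x => ξ (1, x) - ξ (0, x), by fun_prop, fun t x => ?_⟩
    obtain ⟨M, hM⟩ := exists_affine_of_jensen (g := fun t => ξ (t, x)) (by fun_prop) fun t h => by
      by_cases hh : h = 0
      · subst hh
        simp only [add_zero, sub_zero, two_smul]
      · have := H t h x 0
        rw [smul_zero, smul_eq_zero, or_iff_right hh] at this
        simp only [add_zero, sub_zero] at this
        exact sub_eq_zero.mp this
    have hM' : M t = t • M 1 := by rw [← map_smul, smul_eq_mul, mul_one]
    have h1 := hM 1
    have h2 := hM t
    simp only at h1 h2 ⊢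
    rw [h2, h1, hM']
    module
  -- The parts of the identity that are even and odd in `h`.
  have heven : ∀ (t h : ℝ) (x v : E),
      (f (t + h, x) + f (t - h, x) - 2 * f (t, x)) • v = h ^ 2 • (q (x + v) - q (x - v)) := by
    intro t h x v
    have h1 := H t h x v
    have h2 := H t (-h) x v
    simp only [sub_neg_eq_add, ← sub_eq_add_neg] at h2
    simp only [hpq, hL _ (x + v), hL _ (x - v), hL _ x, map_add, map_sub] at h1 h2 ⊢
    linear_combination (norm := module) (-1 / 2 : ℝ) • h1 + (-1 / 2 : ℝ) • h2
  have hodd : ∀ (t : ℝ) (x v : E), (L (t + 1) v - L (t - 1) v) • v =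
      (p (x + v) + p (x - v) - (2 : ℝ) • p x) +
        t • (q (x + v) + q (x - v) - (2 : ℝ) • q x) := by
    intro t x v
    have h1 := H t 1 x v
    have h2 := H t (-1) x v
    simp only [sub_neg_eq_add, ← sub_eq_add_neg] at h2
    simp only [hpq, hL _ (x + v), hL _ (x - v), hL _ x, map_add, map_sub] at h1 h2 ⊢
    linear_combination (norm := module) (-1 / 2 : ℝ) • h1 + (1 / 2 : ℝ) • h2
  have hquad : ∀ (x : E) (t : ℝ), f (t, x) = f (0, x) + t * ((f (1, x) - f (-1, x)) / 2) +
      t ^ 2 * ((f (1, x) + f (-1, x) - 2 * f (0, x)) / 2) := fun x =>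
    eq_quadratic_of_second_difference (g := fun t => f (t, x))
      (K := f (1, x) + f (-1, x) - 2 * f (0, x)) (by fun_prop) fun t h => by
        have h1 := heven t h x e
        have h2 := heven 0 1 x e
        simp only [zero_add, zero_sub, one_pow, one_smul] at h2
        rw [← h2, smul_smul] at h1
        exact smul_left_injective ℝ he h1
  obtain ⟨c, hc⟩ : ∃ c : ℝ, c = (f (1, 0) + f (-1, 0) - 2 * f (0, 0)) / 2 := ⟨_, rfl⟩
  obtain ⟨B, hB⟩ : ∃ B : E →L[ℝ] ℝ, B = (1 / 2 : ℝ) • (L 1 - L (-1)) := ⟨_, rfl⟩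
  obtain ⟨C, hC⟩ : ∃ C : E →L[ℝ] ℝ, C = (1 / 2 : ℝ) • (L 1 + L (-1) - (2 : ℝ) • L 0) := ⟨_, rfl⟩
  have hLt : ∀ t x, L t x = L 0 x + t * B x + t ^ 2 * C x := fun t x => by
    have h1 := hquad x t
    have h2 := hquad 0 t
    simp only [hL _ x] at h1
    simp only [hB, hC, smul_apply, add_apply,
      sub_apply, smul_eq_mul]
    linear_combination h1 - h2
  have hqdiff : ∀ x v, q (x + v) - q (x - v) = (2 * c + 2 * C x) • v := fun x v => by
    have h2 := heven 0 1 x v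
    simp only [zero_add, zero_sub, one_pow, one_smul] at h2
    rw [← h2]
    simp only [hL _ x, hc, hC, smul_apply, add_apply,
      sub_apply, smul_eq_mul]
    congr 1
    ring
  have hq : ∀ y, q y = q 0 + (c + C y / 2) • y := fun y => by
    have := hqdiff ((1 / 2 : ℝ) • y) ((1 / 2 : ℝ) • y)
    rw [sub_self, ← add_smul, show (1 / 2 + 1 / 2 : ℝ) = 1 by norm_num, one_smul, map_smul,
      smul_eq_mul, sub_eq_iff_eq_add'] at this
    rw [this]
    module
  have hC0 : ∀ v, C v = 0 := fun v => by
    by_cases hv : v = 0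
    · rw [hv, map_zero]
    have h0 := hodd 0 0 v
    have h1 := hodd 1 0 v
    rw [hLt, hLt (_ - 1)] at h0 h1
    simp only [zero_add, zero_sub, hq v, hq (-v), map_neg] at h0 h1
    have : (3 * C v) • v = 0 := by
      linear_combination (norm := module) h1 - h0
    rw [smul_eq_zero, or_iff_left hv] at this
    linarith
  have hq' : ∀ y, q y = q 0 + c • y := fun y => by
    rw [hq, hC0, zero_div, add_zero]
  obtain ⟨A, hA⟩ := exists_affine_of_jensen (g := fun x => p x - B x • x)
    (by fun_prop) fun x v => by
      have h0 := hodd 0 x v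
      rw [hLt, hLt (_ - 1)] at h0
      simp only [map_add, map_sub]
      linear_combination (norm := module) -h0
  refine ⟨f (0, 0), (f (1, 0) - f (-1, 0)) / 2, c, p 0, q 0,
    (InnerProductSpace.toDual ℝ E).symm (L 0), (InnerProductSpace.toDual ℝ E).symm B, A,
    fun t x => ⟨?_, ?_⟩⟩
  · rw [inner_add_left, inner_smul_left, InnerProductSpace.toDual_symm_apply,
      InnerProductSpace.toDual_symm_apply, hL, hLt, hC0, hquad 0 t, hc]
    simp only [conj_trivial]
    ring
  · rw [InnerProductSpace.toDual_symm_apply, hpq, hq']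
    have := hA x
    simp only [map_zero, zero_smul, sub_zero] at this
    rw [sub_eq_iff_eq_add.mp this]
    rfl

end FreeMotion

/-- Lie point symmetries of the free equation `d²x/dt² = 0` in `d` spatial dimensions:
`(ξ, f)` is a symmetry iff `f(t,x) = α₀ + α₁ t + α₂ t² + (β₀ + t β₁)·x` and
`ξ(t,x) = a₀ + A x + (β₁·x) x + t (b₀ + α₂ x)`. -/
theorem lie_symmetries_of_free_motion (d : ℕ) (hd : 1 ≤ d)
    (ξ : ℝ × EuclideanSpace ℝ (Fin d) → EuclideanSpace ℝ (Fin d))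
    (f : ℝ × EuclideanSpace ℝ (Fin d) → ℝ)
    (hξ : ContDiff ℝ (⊤ : ℕ∞) ξ) (hf : ContDiff ℝ (⊤ : ℕ∞) f) :
    (∀ x₀ w : EuclideanSpace ℝ (Fin d), ∀ t : ℝ,
        iteratedDeriv 2
          (fun s => ξ (s, x₀ + s • w) - f (s, x₀ + s • w) • w) t = 0)
    ↔ ∃ (α₀ α₁ α₂ : ℝ) (a₀ b₀ β₀ β₁ : EuclideanSpace ℝ (Fin d))
        (A : EuclideanSpace ℝ (Fin d) →ₗ[ℝ] EuclideanSpace ℝ (Fin d)),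
        ∀ (t : ℝ) (x : EuclideanSpace ℝ (Fin d)),
          f (t, x) = α₀ + α₁ * t + α₂ * t ^ 2 + ⟪β₀ + t • β₁, x⟫ ∧
          ξ (t, x) = a₀ + A x + ⟪β₁, x⟫ • x + t • (b₀ + α₂ • x) := by
  constructor
  · intro H
    have : Nonempty (Fin d) := ⟨⟨0, hd⟩⟩
    exact exists_coefficients_of_second_difference hξ.continuous hf.continuous
      (free_motion_second_difference (contDiff_infty.mp hξ 2) (contDiff_infty.mp hf 2) H)
  · rintro ⟨α₀, α₁, α₂, a₀, b₀, β₀, β₁, A, h⟩ x₀ w t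
    have haff : (fun s => ξ (s, x₀ + s • w) - f (s, x₀ + s • w) • w) = fun s : ℝ =>
        (a₀ + A x₀ + ⟪β₁, x₀⟫ • x₀ - (α₀ + ⟪β₀, x₀⟫) • w) +
          s • (A w + ⟪β₁, w⟫ • x₀ + b₀ + α₂ • x₀ - (α₁ + ⟪β₀, w⟫) • w) := by
      funext s
      rw [(h _ _).1, (h _ _).2]
      simp only [map_add, map_smul, inner_add_left, inner_add_right, inner_smul_left,
        inner_smul_right, conj_trivial]
      module
    rw [haff]
    generalize a₀ + A x₀ + ⟪β₁, x₀⟫ • x₀ - (α₀ + ⟪β₀, x₀⟫) • w = U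
    generalize A w + ⟪β₁, w⟫ • x₀ + b₀ + α₂ • x₀ - (α₁ + ⟪β₀, w⟫) • w = V
    have hderiv : deriv (fun s : ℝ => U + s • V) = fun _ => V := by
      funext s
      simpa using (((hasDerivAt_id s).smul_const V).const_add U).deriv
    rw [iteratedDeriv_succ, iteratedDeriv_one, hderiv, deriv_const]
end

section
/- Let d ≥ 1. Smooth functions ξ : ℝ × ℝ^d → ℝ^d and f : ℝ × ℝ^d → ℝ form a Lie point symmetry of the zero-jerk equation d³x/dt³ = 0 — i.e., for every quadratic curve x(t) = x₀ + t w + (t²/2) u (x₀, w, u ∈ ℝ^d) the curve t ↦ ξ(t, x(t)) − (w + t u) f(t, x(t)) has identically vanishing third derivative — if and only if there exist constants α₀, α₁, α₂ ∈ ℝ, vectors a, b, c ∈ ℝ^d and a d×d real matrix A such that for all (t,x): f(t,x) = α₀ + α₁ t + α₂ t² and ξ(t,x) = a + A x + t (b + 2 α₂ x) + t² c. In particular the space of such symmetries has dimension d² + 3d + 3. -/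
open scoped RealInnerProductSpace

section Auxiliary

variable {E : Type*} [NormedAddCommGroup E] [NormedSpace ℝ E]

lemma hasDerivAt_quadratic (a b c : E) (s : ℝ) :
    HasDerivAt (fun s : ℝ => a + s • b + s ^ 2 • c) (b + (2 * s) • c) s := by
  have h1 := (hasDerivAt_id s).smul_const b
  have h2 := (hasDerivAt_pow 2 s).smul_const c
  have h3 := (h1.const_add a).add h2
  simpa using! h3

lemma eq_quadratic_of_hasDerivAt {g : ℝ → E} {b c : E}
    (hg : ∀ s, HasDerivAt g (b + (2 * s) • c) s) (s : ℝ) :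
    g s = g 0 + s • b + s ^ 2 • c := by
  have hd : ∀ r, HasDerivAt (fun r => g r - (g 0 + r • b + r ^ 2 • c)) 0 r := fun r => by
    simpa using! (hg r).sub (hasDerivAt_quadratic (g 0) b c r)
  have := is_const_of_deriv_eq_zero (fun r => (hd r).differentiableAt)
    (fun r => (hd r).deriv) s 0
  simpa [sub_eq_zero] using this

/-- The third derivative of a `C³` curve vanishes iff the curve is quadratic. -/
lemma iteratedDeriv_three_eq_zero_iff {g : ℝ → E} (hg : ContDiff ℝ 3 g) :
    (∀ t, iteratedDeriv 3 g t = 0) ↔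
      ∃ a b c : E, ∀ s : ℝ, g s = a + s • b + s ^ 2 • c := by
  constructor
  · intro h
    have hderiv : ∀ m : ℕ, m < 3 → ∀ s,
        HasDerivAt (iteratedDeriv m g) (iteratedDeriv (m + 1) g s) s := fun m hm s => by
      rw [iteratedDeriv_succ]
      exact (hg.differentiable_iteratedDeriv m (by exact_mod_cast hm) s).hasDerivAt
    have h2 : ∀ s, iteratedDeriv 2 g s = iteratedDeriv 2 g 0 := fun s => by
      have := eq_quadratic_of_hasDerivAt (g := iteratedDeriv 2 g) (b := 0) (c := 0)
        (fun r => by simpa [h r] using hderiv 2 (by norm_num) r) s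
      simpa using this
    have h1 : ∀ s, iteratedDeriv 1 g s = iteratedDeriv 1 g 0 + s • iteratedDeriv 2 g 0 :=
      fun s => by
        have := eq_quadratic_of_hasDerivAt (g := iteratedDeriv 1 g) (b := iteratedDeriv 2 g 0)
          (c := 0) (fun r => by simpa [h2 r] using hderiv 1 (by norm_num) r) s
        simpa using this
    refine ⟨g 0, iteratedDeriv 1 g 0, (2⁻¹ : ℝ) • iteratedDeriv 2 g 0,
      eq_quadratic_of_hasDerivAt fun r => ?_⟩
    have := hderiv 0 (by norm_num) r
    rw [iteratedDeriv_zero, zero_add, h1 r] at this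
    convert this using 1
    module
  · rintro ⟨a, b, c, h⟩ t
    obtain rfl : g = fun s => a + s • b + s ^ 2 • c := funext h
    have h1 : deriv (fun s : ℝ => a + s • b + s ^ 2 • c) = fun s => b + (2 * s) • c :=
      funext fun s => (hasDerivAt_quadratic a b c s).deriv
    have h2 : deriv (fun s : ℝ => b + (2 * s) • c) = fun _ => (2 : ℝ) • c := funext fun s => by
      have := (hasDerivAt_quadratic b ((2 : ℝ) • c) 0 s).deriv
      simpa [smul_smul, mul_comm] using this
    simp only [iteratedDeriv_succ, iteratedDeriv_zero, h1, h2, deriv_const]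

/-- The variation of every quadratic curve under `(ξ, f)` is again a quadratic curve. -/
def MapsQuadraticsToQuadratics (ξ : ℝ × E → E) (f : ℝ × E → ℝ) : Prop :=
  ∀ x₀ w u : E, ∃ a b c : E, ∀ s : ℝ,
    ξ (s, x₀ + s • w + (s ^ 2 / 2) • u) - f (s, x₀ + s • w + (s ^ 2 / 2) • u) • (w + s • u)
      = a + s • b + s ^ 2 • c

namespace MapsQuadraticsToQuadratics

variable {ξ : ℝ × E → E} {f : ℝ × E → ℝ}

/-- The defining property for curves expanded around an arbitrary time `t`. -/
lemma exists_expansion_at (h : MapsQuadraticsToQuadratics ξ f) (t : ℝ) (x v u : E) :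
    ∃ a b c : E, ∀ s : ℝ,
      ξ (t + s, x + s • v + (s ^ 2 / 2) • u)
          - f (t + s, x + s • v + (s ^ 2 / 2) • u) • (v + s • u)
        = a + s • b + s ^ 2 • c := by
  obtain ⟨a, b, c, H⟩ := h (x - t • v + (t ^ 2 / 2) • u) (v - t • u) u
  refine ⟨a + t • b + t ^ 2 • c, b + (2 * t) • c, c, fun s => ?_⟩
  have e1 : x - t • v + (t ^ 2 / 2) • u + (t + s) • (v - t • u) + ((t + s) ^ 2 / 2) • u
      = x + s • v + (s ^ 2 / 2) • u := by module
  have e2 : v - t • u + (t + s) • u = v + s • u := by module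
  have := H (t + s)
  rw [e1, e2] at this
  rw [this]
  module

lemma apply_eq_apply (h : MapsQuadraticsToQuadratics ξ f) (hξ : Continuous ξ)
    (hf : Continuous f) (t : ℝ) (y z : E) : f (t, y) = f (t, z) := by
  by_cases hyz : y = z
  · rw [hyz]
  set v : E := (3⁻¹ : ℝ) • (z - y) with hv
  have hv0 : v ≠ 0 := smul_ne_zero (by norm_num) (sub_ne_zero.2 (Ne.symm hyz))
  -- the curve through `y` at times `t ± s` and through `z` at times `t ± 2 s`
  have key : ∀ s : ℝ, s ≠ 0 →
      s • (ξ (t + 2 * s, z) - ξ (t - 2 * s, z) - (2 : ℝ) • (ξ (t + s, y) - ξ (t - s, y)))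
        = (4 * (f (t + 2 * s, z) + f (t - 2 * s, z) - f (t + s, y) - f (t - s, y))) • v := by
    intro s hs
    obtain ⟨a, b, c, H⟩ := h.exists_expansion_at t (y - v) 0 ((2 / s ^ 2) • v)
    have ey : ∀ r : ℝ, r ^ 2 = s ^ 2 →
        y - v + r • (0 : E) + (r ^ 2 / 2) • (2 / s ^ 2) • v = y := fun r hr => by
      rw [hr, smul_smul, show s ^ 2 / 2 * (2 / s ^ 2) = 1 by field_simp]
      module
    have ez : ∀ r : ℝ, r ^ 2 = 4 * s ^ 2 →
        y - v + r • (0 : E) + (r ^ 2 / 2) • (2 / s ^ 2) • v = z := fun r hr => by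
      rw [hr, smul_smul, show 4 * s ^ 2 / 2 * (2 / s ^ 2) = 4 by field_simp, hv]
      module
    have eu : ∀ r : ℝ, (s * r) • (2 / s ^ 2) • v = (2 * r / s) • v := fun r => by
      rw [smul_smul]
      congr 1
      field_simp
    have H1 := H s
    have H2 := H (-s)
    have H3 := H (2 * s)
    have H4 := H (-(2 * s))
    rw [ey s rfl] at H1
    rw [ey (-s) (by ring)] at H2
    rw [ez (2 * s) (by ring)] at H3
    rw [ez (-(2 * s)) (by ring)] at H4
    rw [← sub_eq_add_neg] at H2 H4
    have e : s * (2 / s ^ 2) * s = 2 := by field_simp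
    have e' : ∀ k : ℝ, (k * (s * (2 / s ^ 2) * s)) • v = (k * 2) • v := fun k => by rw [e]
    linear_combination (norm := module) s • H3 - s • H4 - (2 * s) • H1 + (2 * s) • H2
      + e' (2 * (f (t + 2 * s, z) + f (t - 2 * s, z) - f (t + s, y) - f (t - s, y)))
  have hL : Filter.Tendsto (fun s : ℝ => s • (ξ (t + 2 * s, z) - ξ (t - 2 * s, z)
      - (2 : ℝ) • (ξ (t + s, y) - ξ (t - s, y)))) (nhdsWithin 0 {0}ᶜ) (nhds 0) := by
    have : Continuous (fun s : ℝ => s • (ξ (t + 2 * s, z) - ξ (t - 2 * s, z)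
      - (2 : ℝ) • (ξ (t + s, y) - ξ (t - s, y)))) := by fun_prop
    simpa using (this.tendsto 0).mono_left nhdsWithin_le_nhds
  have hR : Filter.Tendsto (fun s : ℝ =>
      (4 * (f (t + 2 * s, z) + f (t - 2 * s, z) - f (t + s, y) - f (t - s, y))) • v)
      (nhdsWithin 0 {0}ᶜ) (nhds ((4 * (f (t, z) + f (t, z) - f (t, y) - f (t, y))) • v)) := by
    have : Continuous (fun s : ℝ =>
      (4 * (f (t + 2 * s, z) + f (t - 2 * s, z) - f (t + s, y) - f (t - s, y))) • v) := by
      fun_prop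
    simpa using (this.tendsto 0).mono_left nhdsWithin_le_nhds
  have hlim := tendsto_nhds_unique (hL.congr' <| by
    filter_upwards [self_mem_nhdsWithin] with s hs using key s hs) hR
  have := (smul_eq_zero.1 hlim.symm).resolve_right hv0
  linarith

variable {φ : ℝ → ℝ}

lemma apply_add (h : MapsQuadraticsToQuadratics ξ fun p => φ p.1) (t : ℝ) (p r : E) :
    ξ (t, p + r) - ξ (t, 0) = (ξ (t, p) - ξ (t, 0)) + (ξ (t, r) - ξ (t, 0)) := by
  -- the curve through `p + r`, `p`, `3 r`, `0` at times `t`, `t + 1`, `t - 1`, `t + 2`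
  have key : ∀ p r : E, (3 : ℝ) • ξ (t, p + r) = (3 : ℝ) • ξ (t + 1, p)
      + ξ (t + -1, (3 : ℝ) • r) - ξ (t + 2, 0)
      + ((3 * φ t) • ((1 / 2 : ℝ) • (p - (3 : ℝ) • r))
        - (3 * φ (t + 1)) • ((1 / 2 : ℝ) • (p - (3 : ℝ) • r) + (r - p))
        - φ (t + -1) • ((1 / 2 : ℝ) • (p - (3 : ℝ) • r) - (r - p))
        + φ (t + 2) • ((1 / 2 : ℝ) • (p - (3 : ℝ) • r) + (2 : ℝ) • (r - p))) := by
    intro p r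
    obtain ⟨a, b, c, H⟩ := h.exists_expansion_at t (p + r) ((1 / 2 : ℝ) • (p - (3 : ℝ) • r)) (r - p)
    have H0 := H 0
    have H1 := H 1
    have H2 := H (-1)
    have H3 := H 2
    rw [show p + r + (0 : ℝ) • (1 / 2 : ℝ) • (p - (3 : ℝ) • r) + ((0 : ℝ) ^ 2 / 2) • (r - p) = p + r
      by module, add_zero] at H0
    rw [show p + r + (1 : ℝ) • (1 / 2 : ℝ) • (p - (3 : ℝ) • r) + ((1 : ℝ) ^ 2 / 2) • (r - p) = p
      by module] at H1
    rw [show p + r + (-1 : ℝ) • (1 / 2 : ℝ) • (p - (3 : ℝ) • r) + ((-1 : ℝ) ^ 2 / 2) • (r - p)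
      = (3 : ℝ) • r by module] at H2
    rw [show p + r + (2 : ℝ) • (1 / 2 : ℝ) • (p - (3 : ℝ) • r) + ((2 : ℝ) ^ 2 / 2) • (r - p) = 0
      by module] at H3
    dsimp only at H0 H1 H2 H3
    linear_combination (norm := module) (3 : ℝ) • H0 - (3 : ℝ) • H1 - H2 + H3
  have k1 := key p r
  have k2 := key p 0
  have k3 := key 0 r
  have k4 := key 0 0
  simp only [add_zero, zero_add, smul_zero] at k1 k2 k3 k4
  linear_combination (norm := module) (1 / 3 : ℝ) • (k1 - k2 - k3 + k4)

/-- `ξ (t, ·)` is affine. -/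
lemma exists_linearMap (h : MapsQuadraticsToQuadratics ξ fun p => φ p.1) (hξ : Continuous ξ)
    (t : ℝ) : ∃ L : E →ₗ[ℝ] E, ∀ x, ξ (t, x) = ξ (t, 0) + L x := by
  let L : E →+ E :=
    { toFun := fun x => ξ (t, x) - ξ (t, 0)
      map_zero' := sub_self _
      map_add' := h.apply_add t }
  have hL : Continuous L := by
    change Continuous fun x => ξ (t, x) - ξ (t, 0)
    fun_prop
  exact ⟨(L.toRealLinearMap hL : E →L[ℝ] E), fun x => by simp [L]⟩

lemma exists_quadratic_form (h : MapsQuadraticsToQuadratics ξ fun p => φ p.1)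
    (hξ : Continuous ξ) : ∃ (a b c : E) (A B C : E →ₗ[ℝ] E), ∀ (t : ℝ) (x : E),
      ξ (t, x) = a + A x + t • (b + B x) + t ^ 2 • (c + C x) := by
  choose L hL using h.exists_linearMap hξ
  refine ⟨ξ (0, 0), (1 / 2 : ℝ) • (ξ (1, 0) - ξ (-1, 0)),
    (1 / 2 : ℝ) • (ξ (1, 0) + ξ (-1, 0) - (2 : ℝ) • ξ (0, 0)), L 0,
    (1 / 2 : ℝ) • (L 1 - L (-1)), (1 / 2 : ℝ) • (L 1 + L (-1) - (2 : ℝ) • L 0), fun t x => ?_⟩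
  obtain ⟨a, b, c, H⟩ := h x 0 0
  simp only [smul_zero, add_zero, sub_zero] at H
  simp only [LinearMap.smul_apply, LinearMap.sub_apply, LinearMap.add_apply]
  have h0 := H 0
  have h1 := H 1
  have h2 := H (-1)
  have k0 := hL 0 x
  have k1 := hL 1 x
  have k2 := hL (-1) x
  linear_combination (norm := module) H t + (k0 - h0) + (t / 2) • ((k1 - h1) - (k2 - h2))
    + (t ^ 2 / 2) • ((k1 - h1) + (k2 - h2) - (2 : ℝ) • (k0 - h0))

lemma exists_cubic [Nontrivial E] {a b c : E} {A B C : E →ₗ[ℝ] E}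
    (h : MapsQuadraticsToQuadratics ξ fun p => φ p.1)
    (hξ : ∀ (t : ℝ) (x : E), ξ (t, x) = a + A x + t • (b + B x) + t ^ 2 • (c + C x)) :
    ∃ α₀ α₁ α₂ α₃ : ℝ, ∀ t, φ t = α₀ + α₁ * t + α₂ * t ^ 2 + α₃ * t ^ 3 := by
  obtain ⟨e, he⟩ := exists_ne (0 : E)
  obtain ⟨ℓ, hℓ⟩ := SeparatingDual.exists_eq_one (R := ℝ) he
  obtain ⟨p, q, r, H⟩ := h 0 e 0
  refine ⟨ℓ (a - p), ℓ (A e + b - q), ℓ (B e + c - r), ℓ (C e), fun t => ?_⟩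
  have := congrArg ℓ (H t)
  simp only [hξ, smul_zero, add_zero, zero_add, map_add, map_sub, map_smul, smul_eq_mul, hℓ]
    at this ⊢
  linear_combination -this

lemma exists_normal_form [Nontrivial E]
    (h : MapsQuadraticsToQuadratics ξ fun p => φ p.1) (hξ : Continuous ξ) :
    ∃ (α₀ α₁ α₂ : ℝ) (a b c : E) (A : E →ₗ[ℝ] E), ∀ (t : ℝ) (x : E),
      φ t = α₀ + α₁ * t + α₂ * t ^ 2 ∧
      ξ (t, x) = a + A x + t • (b + (2 * α₂) • x) + t ^ 2 • c := by
  obtain ⟨a, b, c, A, B, C, hξ'⟩ := h.exists_quadratic_form hξ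
  obtain ⟨α₀, α₁, α₂, α₃, hφ⟩ := h.exists_cubic hξ'
  have hC : ∀ w, C w = α₃ • w := fun w => by
    obtain ⟨p, q, r, H⟩ := h 0 w 0
    simp only [hξ', hφ, smul_zero, add_zero, zero_add, map_smul] at H
    linear_combination (norm := module) (1 / 6 : ℝ) • (H 2 - (3 : ℝ) • H 1 + (3 : ℝ) • H 0 - H (-1))
  have hB : ∀ u, B u = (2 * α₂) • u ∧ α₃ • u = 0 := fun u => by
    obtain ⟨p, q, r, H⟩ := h 0 0 u
    simp only [hξ', hφ, hC, smul_zero, add_zero, zero_add, map_smul] at H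
    have h0 := H 0
    have h1 := H 1
    have h2 := H 2
    have h3 := H 3
    have h4 := H (-1)
    constructor
    · linear_combination (norm := module) (1 / 3 : ℝ) • (h2 - (3 : ℝ) • h1 + (3 : ℝ) • h0 - h4)
        - (1 / 6 : ℝ) • (h3 - (4 : ℝ) • h2 + (6 : ℝ) • h1 - (4 : ℝ) • h0 + h4)
    · linear_combination (norm := module) (-1 / 12 : ℝ) •
        (h3 - (4 : ℝ) • h2 + (6 : ℝ) • h1 - (4 : ℝ) • h0 + h4)
  obtain ⟨e, he⟩ := exists_ne (0 : E)
  obtain rfl : α₃ = 0 := (smul_eq_zero.1 (hB e).2).resolve_right he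
  refine ⟨α₀, α₁, α₂, a, b, c, A, fun t x => ⟨by rw [hφ]; ring, ?_⟩⟩
  rw [hξ', hC, (hB x).1]
  module

end MapsQuadraticsToQuadratics

end Auxiliary

/-- Lie point symmetries of the zero-jerk equation `d³x/dt³ = 0` in `d` spatial dimensions:
`(ξ, f)` is a symmetry iff `f(t,x) = α₀ + α₁ t + α₂ t²` and
`ξ(t,x) = a + A x + t (b + 2 α₂ x) + t² c`. -/
theorem lie_symmetries_of_zero_jerk (d : ℕ) (hd : 1 ≤ d)
    (ξ : ℝ × EuclideanSpace ℝ (Fin d) → EuclideanSpace ℝ (Fin d))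
    (f : ℝ × EuclideanSpace ℝ (Fin d) → ℝ)
    (hξ : ContDiff ℝ (⊤ : ℕ∞) ξ) (hf : ContDiff ℝ (⊤ : ℕ∞) f) :
    (∀ x₀ w u : EuclideanSpace ℝ (Fin d), ∀ t : ℝ,
        iteratedDeriv 3
          (fun s => ξ (s, x₀ + s • w + (s ^ 2 / 2) • u)
            - f (s, x₀ + s • w + (s ^ 2 / 2) • u) • (w + s • u)) t = 0)
    ↔ ∃ (α₀ α₁ α₂ : ℝ) (a b c : EuclideanSpace ℝ (Fin d))
        (A : EuclideanSpace ℝ (Fin d) →ₗ[ℝ] EuclideanSpace ℝ (Fin d)),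
        ∀ (t : ℝ) (x : EuclideanSpace ℝ (Fin d)),
          f (t, x) = α₀ + α₁ * t + α₂ * t ^ 2 ∧
          ξ (t, x) = a + A x + t • (b + (2 * α₂) • x) + t ^ 2 • c := by
  have : Nonempty (Fin d) := ⟨⟨0, hd⟩⟩
  have hiff : (∀ x₀ w u : EuclideanSpace ℝ (Fin d), ∀ t : ℝ,
        iteratedDeriv 3
          (fun s => ξ (s, x₀ + s • w + (s ^ 2 / 2) • u)
            - f (s, x₀ + s • w + (s ^ 2 / 2) • u) • (w + s • u)) t = 0)
      ↔ MapsQuadraticsToQuadratics ξ f := by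
    refine forall₃_congr fun x₀ w u => iteratedDeriv_three_eq_zero_iff ?_
    have hξ3 : ContDiff ℝ 3 ξ := contDiff_infty.1 hξ 3
    have hf3 : ContDiff ℝ 3 f := contDiff_infty.1 hf 3
    fun_prop
  rw [hiff]
  constructor
  · intro h
    obtain ⟨φ, rfl⟩ : ∃ φ : ℝ → ℝ, f = fun p => φ p.1 :=
      ⟨fun t => f (t, 0), funext fun p => h.apply_eq_apply hξ.continuous hf.continuous _ _ _⟩
    exact h.exists_normal_form hξ.continuous
  · rintro ⟨α₀, α₁, α₂, a, b, c, A, H⟩ x₀ w u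
    refine ⟨a + A x₀ - α₀ • w, A w + b + (2 * α₂) • x₀ - α₀ • u - α₁ • w,
      (1 / 2 : ℝ) • A u + (2 * α₂) • w + c - α₁ • u - α₂ • w, fun s => ?_⟩
    rw [(H _ _).1, (H _ _).2]
    simp only [map_add, map_smul]
    module
end

section
/- Let d ≥ 1. Smooth functions ξ : ℝ × ℝ^d → ℝ^d and f : ℝ × ℝ^d → ℝ form a Lie point symmetry of the zero-snap equation d⁴x/dt⁴ = 0 — i.e., for every cubic curve x(t) = x₀ + t w + (t²/2) u + (t³/6) z (x₀, w, u, z ∈ ℝ^d) the curve t ↦ ξ(t, x(t)) − x'(t) f(t, x(t)) has identically vanishing fourth derivative — if and only if there exist constants α₀, α₁, α₂ ∈ ℝ, vectors a, b, c, e ∈ ℝ^d and a d×d real matrix A such that for all (t,x): f(t,x) = α₀ + α₁ t + α₂ t² and ξ(t,x) = a + A x + t (b + 3 α₂ x) + t² c + t³ e. In particular the space of such symmetries has dimension d² + 4d + 3. -/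
section ZeroSnap

open Asymptotics Topology Filter

variable {E : Type*} [NormedAddCommGroup E] [NormedSpace ℝ E]

lemma hasDerivAt_sum_sub_pow_smul (n : ℕ) (c : ℕ → E) (t s : ℝ) :
    HasDerivAt (fun r : ℝ => ∑ i ∈ Finset.range (n + 1), (r - t) ^ i • c i)
      (∑ i ∈ Finset.range n, (s - t) ^ i • ((i + 1 : ℝ) • c (i + 1))) s := by
  have key : HasDerivAt (fun r : ℝ => ∑ i ∈ Finset.range (n + 1), (r - t) ^ i • c i)
      (∑ i ∈ Finset.range (n + 1), ((i : ℝ) * (s - t) ^ (i - 1)) • c i) s := by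
    refine HasDerivAt.fun_sum fun i _ => HasDerivAt.smul_const ?_ (c i)
    simpa using ((hasDerivAt_id s).sub_const t).fun_pow i
  rw [Finset.sum_range_succ'] at key
  convert key using 1
  simp [smul_smul, mul_comm]

lemma iteratedDeriv_sum_sub_pow_smul (n : ℕ) (c : ℕ → E) (t : ℝ) :
    iteratedDeriv n (fun r : ℝ => ∑ i ∈ Finset.range n, (r - t) ^ i • c i) = 0 := by
  induction n generalizing c with
  | zero => ext; simp
  | succ n ih =>
    rw [iteratedDeriv_succ', funext fun s => (hasDerivAt_sum_sub_pow_smul n c t s).deriv]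
    exact ih _

lemma exists_eq_sum_of_iteratedDeriv_eq_zero (n : ℕ) (t : ℝ) {g : ℝ → E}
    (hg : ContDiff ℝ n g) (h : ∀ s, iteratedDeriv n g s = 0) :
    ∃ c : ℕ → E, ∀ s, g s = ∑ i ∈ Finset.range n, (s - t) ^ i • c i := by
  induction n generalizing g with
  | zero => exact ⟨0, fun s => by simpa using h s⟩
  | succ n ih =>
    rw [iteratedDeriv_succ'] at h
    have hg' : ContDiff ℝ ((n : WithTop ℕ∞) + 1) g := by exact_mod_cast hg
    obtain ⟨c, hc⟩ := ih (contDiff_succ_iff_deriv.1 hg').2.2 h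
    have hdiff : Differentiable ℝ g := (contDiff_succ_iff_deriv.1 hg').1
    let c' : ℕ → E := fun i => Nat.casesOn i (g t) fun j => ((j : ℝ) + 1)⁻¹ • c j
    refine ⟨c', fun s => ?_⟩
    have hD : ∀ r, HasDerivAt
        (fun r => g r - ∑ i ∈ Finset.range (n + 1), (r - t) ^ i • c' i) 0 r := by
      intro r
      convert (hdiff r).hasDerivAt.fun_sub (hasDerivAt_sum_sub_pow_smul n c' t r) using 1
      rw [hc r, eq_comm, sub_eq_zero]
      refine Finset.sum_congr rfl fun i _ => ?_
      have : (i : ℝ) + 1 ≠ 0 := by positivity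
      simp [c', smul_smul, this]
    have := is_const_of_deriv_eq_zero (fun r => (hD r).differentiableAt)
      (fun r => (hD r).deriv) s t
    simpa [Finset.sum_range_succ', c', sub_eq_zero] using this

lemma eq_zero_of_sum_sub_pow_smul_isLittleO (n : ℕ) (c : ℕ → E) (t : ℝ)
    (h : (fun s : ℝ => ∑ i ∈ Finset.range (n + 1), (s - t) ^ i • c i)
      =o[𝓝[≠] t] fun s => (s - t) ^ n) : ∀ i ≤ n, c i = 0 := by
  have h0 {m : ℕ} {c : ℕ → E} (h : (fun s : ℝ => ∑ i ∈ Finset.range (m + 1), (s - t) ^ i • c i)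
      =o[𝓝[≠] t] fun s => (s - t) ^ m) : c 0 = 0 := by
    have hlim : Tendsto (fun s : ℝ => ∑ i ∈ Finset.range (m + 1), (s - t) ^ i • c i)
        (𝓝[≠] t) (𝓝 (c 0)) := by
      have hcont : Continuous (fun s : ℝ => ∑ i ∈ Finset.range (m + 1), (s - t) ^ i • c i) := by
        fun_prop
      convert (hcont.tendsto t).mono_left nhdsWithin_le_nhds using 2
      simp [Finset.sum_range_succ']
    have hO : (fun s : ℝ => (s - t) ^ m) =O[𝓝[≠] t] fun _ => (1 : ℝ) := by
      have hcont : Continuous fun s : ℝ => (s - t) ^ m := by fun_prop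
      exact ((hcont.tendsto t).mono_left nhdsWithin_le_nhds).isBigO_one ℝ
    exact tendsto_nhds_unique hlim ((isLittleO_one_iff ℝ).1 (h.trans_isBigO hO))
  induction n generalizing c with
  | zero => intro i hi; rw [Nat.le_zero.1 hi]; exact h0 h
  | succ n ih =>
    have hc0 := h0 h
    have hdiv := (isBigO_refl (fun s : ℝ => (s - t)⁻¹) (𝓝[≠] t)).smul_isLittleO h
    have hc := ih (fun i => c (i + 1)) <| by
      refine hdiv.congr' ?_ ?_
      all_goals
        filter_upwards [self_mem_nhdsWithin] with s hs
        have hs' : s - t ≠ 0 := sub_ne_zero.2 hs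
      · rw [Finset.sum_range_succ', hc0, smul_zero, add_zero, Finset.smul_sum]
        refine Finset.sum_congr rfl fun i _ => ?_
        rw [smul_smul, pow_succ', inv_mul_cancel_left₀ hs']
      · rw [smul_eq_mul, pow_succ', inv_mul_cancel_left₀ hs']
    rintro (_ | i) hi
    · exact hc0
    · exact hc i (by omega)

/-- Every curve `x` of degree at most three is sent by `(ξ, f)` to a curve
`ξ(s, x(s)) - f(s, x(s)) x'(s)` of degree at most three. -/
def MapsCubicsToCubics (ξ : ℝ × E → E) (f : ℝ × E → ℝ) : Prop :=
  ∀ (x₀ w u z : E) (t : ℝ), ∃ c : ℕ → E, ∀ s : ℝ,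
    ξ (s, x₀ + s • w + (s ^ 2 / 2) • u + (s ^ 3 / 6) • z)
      - f (s, x₀ + s • w + (s ^ 2 / 2) • u + (s ^ 3 / 6) • z) • (w + s • u + (s ^ 2 / 2) • z)
      = ∑ i ∈ Finset.range 4, (s - t) ^ i • c i

lemma mapsCubicsToCubics_of_iteratedDeriv_eq_zero {ξ : ℝ × E → E} {f : ℝ × E → ℝ}
    (hξ : ContDiff ℝ (⊤ : ℕ∞) ξ) (hf : ContDiff ℝ (⊤ : ℕ∞) f)
    (h : ∀ x₀ w u z : E, ∀ t : ℝ,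
        iteratedDeriv 4
          (fun s => ξ (s, x₀ + s • w + (s ^ 2 / 2) • u + (s ^ 3 / 6) • z)
            - f (s, x₀ + s • w + (s ^ 2 / 2) • u + (s ^ 3 / 6) • z)
              • (w + s • u + (s ^ 2 / 2) • z)) t = 0) :
    MapsCubicsToCubics ξ f := by
  intro x₀ w u z t
  refine exists_eq_sum_of_iteratedDeriv_eq_zero 4 t ?_ (h x₀ w u z)
  have hξ' : ContDiff ℝ (4 : ℕ) ξ := hξ.of_le (WithTop.coe_le_coe.2 le_top)
  have hf' : ContDiff ℝ (4 : ℕ) f := hf.of_le (WithTop.coe_le_coe.2 le_top)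
  fun_prop

namespace MapsCubicsToCubics

variable {ξ : ℝ × E → E} {f : ℝ × E → ℝ}

lemma exists_sum_cubed_curve (H : MapsCubicsToCubics ξ f) (t : ℝ) (x z : E) :
    ∃ c : ℕ → E, ∀ s : ℝ,
      ξ (s, x + (s - t) ^ 3 • z) - f (s, x + (s - t) ^ 3 • z) • (3 * (s - t) ^ 2) • z
        = ∑ i ∈ Finset.range 4, (s - t) ^ i • c i := by
  obtain ⟨c, hc⟩ := H (x - t ^ 3 • z) ((3 * t ^ 2) • z) (-(6 * t) • z) ((6 : ℝ) • z) t
  refine ⟨c, fun s => ?_⟩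
  rw [← hc s]
  have h1 : x - t ^ 3 • z + s • (3 * t ^ 2) • z + (s ^ 2 / 2) • -(6 * t) • z
      + (s ^ 3 / 6) • (6 : ℝ) • z = x + (s - t) ^ 3 • z := by module
  have h2 : (3 * t ^ 2) • z + s • -(6 * t) • z + (s ^ 2 / 2) • (6 : ℝ) • z
      = (3 * (s - t) ^ 2) • z := by module
  rw [h1, h2]

lemma exists_sum_const_curve (H : MapsCubicsToCubics ξ f) (t : ℝ) (x : E) :
    ∃ c : ℕ → E, ∀ s : ℝ, ξ (s, x) = ∑ i ∈ Finset.range 4, (s - t) ^ i • c i := by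
  simpa using H.exists_sum_cubed_curve t x 0

lemma exists_linear_expansion (H : MapsCubicsToCubics ξ f) (t : ℝ) (x : E)
    (hξ : ContDiffAt ℝ 1 ξ (t, x)) (hf : DifferentiableAt ℝ f (t, x)) :
    ∃ L : E →ₗ[ℝ] E, ∀ (s : ℝ) (z : E),
      ξ (s, x + (s - t) ^ 3 • z) - f (s, x + (s - t) ^ 3 • z) • (3 * (s - t) ^ 2) • z
        = ξ (s, x) - f (t, x) • (3 * (s - t) ^ 2) • z + (s - t) ^ 3 • L z := by
  set ξ' := fderiv ℝ ξ (t, x)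
  set f' := fderiv ℝ f (t, x)
  obtain ⟨L, hL⟩ : ∃ L : E →ₗ[ℝ] E, ∀ z, L z = ξ' (0, z) - (3 * f' (1, 0)) • z :=
    ⟨ξ'.toLinearMap ∘ₗ LinearMap.inr ℝ ℝ E - (3 * f' (1, 0)) • LinearMap.id, fun z => by simp⟩
  refine ⟨L, fun s z => ?_⟩
  obtain ⟨c, hc⟩ := H.exists_sum_cubed_curve t x z
  obtain ⟨k, hk⟩ := H.exists_sum_const_curve t x
  have hcurve : HasDerivAt (fun s : ℝ => (s, x + (s - t) ^ 3 • z)) ((1 : ℝ), (0 : E)) t := by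
    refine (hasDerivAt_id t).prodMk ?_
    have := ((((hasDerivAt_id t).sub_const t).fun_pow 3).smul_const z).const_add x
    simpa using this
  have hfo : (fun s : ℝ => f (s, x + (s - t) ^ 3 • z) - f (t, x) - (s - t) • f' (1, 0))
      =o[𝓝 t] fun s => s - t := by
    have hbase : HasFDerivAt f f' (t, x + (t - t) ^ 3 • z) := by simpa using hf.hasFDerivAt
    simpa using hasDerivAt_iff_isLittleO.1 (hbase.comp_hasDerivAt t hcurve)
  have hξo : (fun s : ℝ => ξ (s, x + (s - t) ^ 3 • z) - ξ (s, x) - (s - t) ^ 3 • ξ' (0, z))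
      =o[𝓝 t] fun s => (s - t) ^ 3 := by
    have hstrict := (hξ.hasStrictFDerivAt one_ne_zero).isLittleO
    have htend : Tendsto (fun s : ℝ => ((s, x + (s - t) ^ 3 • z), (s, x))) (𝓝 t)
        (𝓝 ((t, x), (t, x))) := by
      have hcont : Continuous (fun s : ℝ => ((s, x + (s - t) ^ 3 • z), (s, x))) := by fun_prop
      simpa using hcont.tendsto t
    refine ((hstrict.comp_tendsto htend).congr_left fun s => ?_).trans_isBigO ?_
    · rw [← map_smul]
      simp [ξ', -map_smul, -map_sub]
    · refine IsBigO.of_bound ‖z‖ (Eventually.of_forall fun s => le_of_eq ?_)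
      have : 0 ≤ ‖z‖ * |s - t| ^ 3 := by positivity
      simpa [norm_smul, mul_comm] using this
  have hfo' : (fun s : ℝ => ((s - t) ^ 2 • (f (s, x + (s - t) ^ 3 • z) - f (t, x)
      - (s - t) • f' (1, 0))) • (3 : ℝ) • z) =o[𝓝 t] fun s => (s - t) ^ 3 := by
    refine (((isBigO_refl (fun s : ℝ => (s - t) ^ 2) (𝓝 t)).smul_isLittleO hfo).smul_isBigO
      (isBigO_refl (fun _ : ℝ => (3 : ℝ) • z) (𝓝 t))).trans_isBigO ?_
    refine IsBigO.of_bound (3 * ‖z‖) (Eventually.of_forall fun s => le_of_eq ?_)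
    simp only [norm_smul, Real.norm_eq_abs, abs_mul, abs_pow, smul_eq_mul, Nat.abs_ofNat]
    ring
  have hzero := eq_zero_of_sum_sub_pow_smul_isLittleO 3 (fun i => c i - k i
      + (if i = 2 then (3 * f (t, x)) • z else 0) - (if i = 3 then L z else 0)) t <| by
    refine ((hξo.sub hfo').mono nhdsWithin_le_nhds).congr_left fun s => ?_
    have e1 := hc s
    have e2 := hk s
    simp only [Finset.sum_range_succ, Finset.sum_range_zero] at e1 e2 ⊢
    norm_num at e1 e2 ⊢
    linear_combination (norm := module) e1 - e2 + (s - t) ^ 3 • hL z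
  have z0 := hzero 0 (by norm_num)
  have z1 := hzero 1 (by norm_num)
  have z2 := hzero 2 (by norm_num)
  have z3 := hzero 3 (by norm_num)
  rw [hc s, hk s]
  simp only [Finset.sum_range_succ, Finset.sum_range_zero]
  norm_num at z0 z1 z2 z3 ⊢
  linear_combination (norm := module) z0 + (s - t) • z1 + (s - t) ^ 2 • z2 + (s - t) ^ 3 • z3

lemma exists_linear_of_contDiff (H : MapsCubicsToCubics ξ f)
    (hξ : ContDiff ℝ 1 ξ) (hf : Differentiable ℝ f) (s : ℝ) :
    (∃ M : E →ₗ[ℝ] E, ∀ y, ξ (s, y) = ξ (s, 0) + M y) ∧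
      ∃ B : E →ₗ[ℝ] E, ∀ y, f (s, y) • y = B y := by
  obtain ⟨L, hL⟩ := H.exists_linear_expansion (s - 1) 0 hξ.contDiffAt (hf _)
  obtain ⟨L', hL'⟩ := H.exists_linear_expansion (s + 1) 0 hξ.contDiffAt (hf _)
  have e1 (y : E) : ξ (s, y) - f (s, y) • (3 : ℝ) • y
      = ξ (s, 0) - f (s - 1, 0) • (3 : ℝ) • y + L y := by
    simpa using hL s y
  have e2 (y : E) : ξ (s, y) + f (s, y) • (3 : ℝ) • y
      = ξ (s, 0) + f (s + 1, 0) • (3 : ℝ) • y + L' y := by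
    simpa [Odd.neg_pow (by decide : Odd 3)] using hL' s (-y)
  constructor
  · refine ⟨(1 / 2 : ℝ) • (L + L' + (3 * (f (s + 1, 0) - f (s - 1, 0))) • LinearMap.id),
      fun y => ?_⟩
    simp only [LinearMap.smul_apply, LinearMap.add_apply, LinearMap.id_apply]
    linear_combination (norm := module) (1 / 2 : ℝ) • e1 y + (1 / 2 : ℝ) • e2 y
  · refine ⟨(1 / 6 : ℝ) • (L' - L + (3 * (f (s + 1, 0) + f (s - 1, 0))) • LinearMap.id),
      fun y => ?_⟩
    simp only [LinearMap.smul_apply, LinearMap.add_apply, LinearMap.sub_apply, LinearMap.id_apply]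
    linear_combination (norm := module) (1 / 6 : ℝ) • e2 y - (1 / 6 : ℝ) • e1 y

lemma eq_apply_zero (H : MapsCubicsToCubics ξ f)
    (hξ : ContDiff ℝ 1 ξ) (hf : Differentiable ℝ f) (s : ℝ) (y : E) : f (s, y) = f (s, 0) := by
  rcases eq_or_ne y 0 with rfl | hy
  · rfl
  obtain ⟨B, hB⟩ := (H.exists_linear_of_contDiff hξ hf s).2
  have hscale (r : ℝ) (hr : r ≠ 0) : f (s, r • y) = f (s, y) := by
    have h1 := hB (r • y)
    rw [map_smul, ← hB y, smul_comm] at h1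
    exact smul_left_injective ℝ hy (smul_right_injective E hr h1)
  have hcont : Continuous fun r : ℝ => f (s, r • y) := by
    have := hf.continuous
    fun_prop
  have hlim : Tendsto (fun r : ℝ => f (s, r • y)) (𝓝[≠] 0) (𝓝 (f (s, 0))) := by
    simpa using (hcont.tendsto 0).mono_left nhdsWithin_le_nhds
  refine tendsto_nhds_unique (tendsto_const_nhds.congr' ?_) hlim
  filter_upwards [self_mem_nhdsWithin] with r hr using (hscale r hr).symm

end MapsCubicsToCubics

lemma eq_zero_of_forall_sum_pow_smul_eq_zero (n : ℕ) (c : ℕ → E)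
    (h : ∀ s : ℝ, ∑ i ∈ Finset.range (n + 1), s ^ i • c i = 0) : ∀ i ≤ n, c i = 0 :=
  eq_zero_of_sum_sub_pow_smul_isLittleO n c 0 (by simp [h])

lemma exists_affine_quadratic_of_cubic {M F : ℝ → E} {m q r n : ℕ → E}
    (hm : ∀ s, M s = ∑ i ∈ Finset.range 4, s ^ i • m i)
    (hq : ∀ s, s • M s - F s = ∑ i ∈ Finset.range 4, s ^ i • q i)
    (hr : ∀ s, s ^ 2 • M s - (2 * s) • F s = ∑ i ∈ Finset.range 4, s ^ i • r i)
    (hn : ∀ s, s ^ 3 • M s - (3 * s ^ 2) • F s = ∑ i ∈ Finset.range 4, s ^ i • n i) :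
    ∃ a b c d : E, ∀ s, M s = a + s • (3 : ℝ) • d ∧ F s = b + s • c + s ^ 2 • d := by
  simp only [Finset.sum_range_succ, Finset.sum_range_zero, zero_add] at hm hq hr hn
  have h5 := eq_zero_of_forall_sum_pow_smul_eq_zero 5
    (fun i => match i with
      | 0 => r 0 | 1 => r 1 - (2 : ℝ) • q 0 | 2 => r 2 - (2 : ℝ) • q 1 + m 0
      | 3 => r 3 - (2 : ℝ) • q 2 + m 1 | 4 => m 2 - (2 : ℝ) • q 3 | _ => m 3) <| by
    intro s
    simp only [Finset.sum_range_succ, Finset.sum_range_zero, zero_add]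
    linear_combination (norm := module) (2 * s) • hq s - hr s - s ^ 2 • hm s
  have h6 := eq_zero_of_forall_sum_pow_smul_eq_zero 5
    (fun i => match i with
      | 0 => n 0 | 1 => n 1 | 2 => n 2 - (3 : ℝ) • q 0
      | 3 => n 3 - (3 : ℝ) • q 1 + (2 : ℝ) • m 0 | 4 => (2 : ℝ) • m 1 - (3 : ℝ) • q 2
      | _ => (2 : ℝ) • m 2 - (3 : ℝ) • q 3) <| by
    intro s
    have h3 : m 3 = 0 := h5 5 le_rfl
    simp only [Finset.sum_range_succ, Finset.sum_range_zero, zero_add]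
    linear_combination (norm := module) (3 * s ^ 2) • hq s - hn s - (2 * s ^ 3) • hm s
      - (2 * s ^ 6) • h3
  have m3 : m 3 = 0 := h5 5 le_rfl
  have e4 : m 2 - (2 : ℝ) • q 3 = 0 := h5 4 (by norm_num)
  have e5 : (2 : ℝ) • m 2 - (3 : ℝ) • q 3 = 0 := h6 5 le_rfl
  have e6 : (2 : ℝ) • m 1 - (3 : ℝ) • q 2 = 0 := h6 4 (by norm_num)
  have q3 : q 3 = 0 := by linear_combination (norm := module) e5 - (2 : ℝ) • e4
  have m2 : m 2 = 0 := by linear_combination (norm := module) e4 + (2 : ℝ) • q3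
  have hM (s : ℝ) : M s = m 0 + s • m 1 := by
    linear_combination (norm := module) hm s + s ^ 2 • m2 + s ^ 3 • m3
  refine ⟨m 0, -q 0, m 0 - q 1, (1 / 3 : ℝ) • m 1, fun s => ⟨?_, ?_⟩⟩
  · linear_combination (norm := module) hM s
  · linear_combination (norm := module) s • hM s - hq s - s ^ 3 • q3 + (s ^ 2 / 3) • e6

lemma MapsCubicsToCubics.exists_coeff [Nontrivial E] {ξ : ℝ × E → E} {f : ℝ × E → ℝ}
    (H : MapsCubicsToCubics ξ f) (hξ : ContDiff ℝ 1 ξ) (hf : Differentiable ℝ f) :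
    ∃ (α₀ α₁ α₂ : ℝ) (a b c e : E) (A : E →ₗ[ℝ] E), ∀ (t : ℝ) (x : E),
      f (t, x) = α₀ + α₁ * t + α₂ * t ^ 2 ∧
      ξ (t, x) = a + A x + t • (b + (3 * α₂) • x) + t ^ 2 • c + t ^ 3 • e := by
  obtain ⟨F, hF⟩ : ∃ F : ℝ → ℝ, ∀ s y, f (s, y) = F s := ⟨_, H.eq_apply_zero hξ hf⟩
  obtain ⟨P, M, hM⟩ : ∃ (P : ℝ → E) (M : ℝ → E →ₗ[ℝ] E), ∀ s y, ξ (s, y) = P s + M s y := by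
    choose M hM using fun s => (H.exists_linear_of_contDiff hξ hf s).1
    exact ⟨_, M, hM⟩
  obtain ⟨p, hp⟩ := H.exists_sum_const_curve 0 0
  have key (w : E) : ∃ a b c d : E, ∀ s, M s w = a + s • (3 : ℝ) • d ∧
      F s • w = b + s • c + s ^ 2 • d := by
    obtain ⟨m, hm⟩ := H.exists_sum_const_curve 0 w
    obtain ⟨q, hq⟩ := H 0 w 0 0 0
    obtain ⟨r, hr⟩ := H 0 0 ((2 : ℝ) • w) 0 0
    obtain ⟨n, hn⟩ := H 0 0 0 ((6 : ℝ) • w) 0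
    refine exists_affine_quadratic_of_cubic (m := m - p) (q := q - p) (r := r - p) (n := n - p)
      (fun s => ?_) (fun s => ?_) (fun s => ?_) (fun s => ?_)
    all_goals
      simp only [Pi.sub_apply, smul_sub, Finset.sum_sub_distrib]
      have hps := hp s
      have hms := hm s
      have hqs := hq s
      have hrs := hr s
      have hns := hn s
      simp only [hF, hM, smul_zero, add_zero, zero_add, map_smul, map_zero, sub_zero]
        at hps hms hqs hrs hns
    · linear_combination (norm := module) hms - hps
    · linear_combination (norm := module) hqs - hps
    · linear_combination (norm := module) hrs - hps
    · linear_combination (norm := module) hns - hps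
  obtain ⟨v, hv⟩ := exists_ne (0 : E)
  obtain ⟨φ, hφ⟩ := SeparatingDual.exists_eq_one (R := ℝ) hv
  obtain ⟨_, b, c, d, hv'⟩ := key v
  have hquad (s : ℝ) : F s = φ b + φ c * s + φ d * s ^ 2 := by
    have := congrArg φ (hv' s).2
    simp only [map_smul, map_add, hφ, smul_eq_mul] at this
    linear_combination this
  have hMs (s : ℝ) (w : E) : M s w = M 0 w + s • (3 * φ d) • w := by
    obtain ⟨a', b', c', d', h⟩ := key w
    have hd : d' = φ d • w := by
      have h0 := (h 0).2
      have h1 := (h 1).2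
      have h2 := (h (-1)).2
      rw [hquad] at h0 h1 h2
      linear_combination (norm := module) h0 - (1 / 2 : ℝ) • h1 - (1 / 2 : ℝ) • h2
    linear_combination (norm := module) (h s).1 - (h 0).1 + (3 * s) • hd
  refine ⟨φ b, φ c, φ d, p 0, p 1, p 2, p 3, M 0, fun t x => ⟨?_, ?_⟩⟩
  · rw [hF, hquad]
  · have hpt := hp t
    simp only [hM, map_zero, add_zero, Finset.sum_range_succ, Finset.sum_range_zero, sub_zero]
      at hpt
    linear_combination (norm := module) hM t x + hpt + hMs t x

lemma iteratedDeriv_eq_zero_of_coeff {ξ : ℝ × E → E} {f : ℝ × E → ℝ} {α₀ α₁ α₂ : ℝ}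
    {a b c e : E} {A : E →ₗ[ℝ] E}
    (h : ∀ (t : ℝ) (x : E), f (t, x) = α₀ + α₁ * t + α₂ * t ^ 2 ∧
      ξ (t, x) = a + A x + t • (b + (3 * α₂) • x) + t ^ 2 • c + t ^ 3 • e)
    (x₀ w u z : E) (t : ℝ) :
    iteratedDeriv 4
      (fun s => ξ (s, x₀ + s • w + (s ^ 2 / 2) • u + (s ^ 3 / 6) • z)
        - f (s, x₀ + s • w + (s ^ 2 / 2) • u + (s ^ 3 / 6) • z)
          • (w + s • u + (s ^ 2 / 2) • z)) t = 0 := by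
  have hpoly := congrFun (iteratedDeriv_sum_sub_pow_smul 4 (fun i => match i with
    | 0 => a + A x₀ - α₀ • w
    | 1 => A w + b + (3 * α₂) • x₀ - α₀ • u - α₁ • w
    | 2 => (1 / 2 : ℝ) • A u + (2 * α₂) • w + c - (α₀ / 2) • z - α₁ • u
    | _ => (1 / 6 : ℝ) • A z + (α₂ / 2) • u + e - (α₁ / 2) • z) 0) t
  rw [Pi.zero_apply] at hpoly
  rw [← hpoly]
  congr 1
  ext s
  simp only [(h _ _).1, (h _ _).2, map_add, map_smul, Finset.sum_range_succ,
    Finset.sum_range_zero, sub_zero]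
  module

end ZeroSnap

/-- Lie point symmetries of the zero-snap equation `d⁴x/dt⁴ = 0` in `d` spatial dimensions:
`(ξ, f)` is a symmetry iff `f(t,x) = α₀ + α₁ t + α₂ t²` and
`ξ(t,x) = a + A x + t (b + 3 α₂ x) + t² c + t³ e`. -/
theorem lie_symmetries_of_zero_snap (d : ℕ) (hd : 1 ≤ d)
    (ξ : ℝ × EuclideanSpace ℝ (Fin d) → EuclideanSpace ℝ (Fin d))
    (f : ℝ × EuclideanSpace ℝ (Fin d) → ℝ)
    (hξ : ContDiff ℝ (⊤ : ℕ∞) ξ) (hf : ContDiff ℝ (⊤ : ℕ∞) f) :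
    (∀ x₀ w u z : EuclideanSpace ℝ (Fin d), ∀ t : ℝ,
        iteratedDeriv 4
          (fun s => ξ (s, x₀ + s • w + (s ^ 2 / 2) • u + (s ^ 3 / 6) • z)
            - f (s, x₀ + s • w + (s ^ 2 / 2) • u + (s ^ 3 / 6) • z)
              • (w + s • u + (s ^ 2 / 2) • z)) t = 0)
    ↔ ∃ (α₀ α₁ α₂ : ℝ) (a b c e : EuclideanSpace ℝ (Fin d))
        (A : EuclideanSpace ℝ (Fin d) →ₗ[ℝ] EuclideanSpace ℝ (Fin d)),
        ∀ (t : ℝ) (x : EuclideanSpace ℝ (Fin d)),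
          f (t, x) = α₀ + α₁ * t + α₂ * t ^ 2 ∧
          ξ (t, x) = a + A x + t • (b + (3 * α₂) • x) + t ^ 2 • c + t ^ 3 • e := by
  have : Nonempty (Fin d) := ⟨⟨0, hd⟩⟩
  constructor
  · intro h
    exact (mapsCubicsToCubics_of_iteratedDeriv_eq_zero hξ hf h).exists_coeff
      (hξ.of_le (WithTop.coe_le_coe.2 le_top)) (hf.differentiable (by simp))
  · rintro ⟨α₀, α₁, α₂, a, b, c, e, A, h⟩
    exact iteratedDeriv_eq_zero_of_coeff h
end

section
/- Let d ≥ 1 and n ≥ 3. Smooth functions ξ : ℝ × ℝ^d → ℝ^d and f : ℝ × ℝ^d → ℝ form a Lie point symmetry of the equation dⁿx/dtⁿ = 0 — i.e., for every ℝ^d-valued polynomial curve x of degree ≤ n−1 the curve t ↦ ξ(t, x(t)) − x'(t) f(t, x(t)) has identically vanishing n-th derivative — if and only if there exist constants α₀, α₁, α₂ ∈ ℝ, vectors a, b, c₂, c₃, …, c_{n−1} ∈ ℝ^d and a d×d real matrix A such that for all (t,x): f(t,x) = α₀ + α₁ t + α₂ t² and ξ(t,x) = a + A x + t (b + (n−1)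 α₂ x) + Σ_{k=2}^{n−1} t^k c_k. In particular the space of such symmetries has dimension d² + n d + 3. -/
open scoped RealInnerProductSpace
open Filter Topology

section PolynomialCurves

variable {E : Type*} [NormedAddCommGroup E] [NormedSpace ℝ E]

/-- The space of `E`-valued polynomial curves of degree `< n`. -/
def polyCurves (E : Type*) [NormedAddCommGroup E] [NormedSpace ℝ E] (n : ℕ) :
    Submodule ℝ (ℝ → E) :=
  LinearMap.range
    ({ toFun := fun p s => ∑ k : Fin n, s ^ (k : ℕ) • p k
       map_add' := fun p q => by
        ext s
        simp [smul_add, Finset.sum_add_distrib]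
       map_smul' := fun c p => by
        ext s
        simp [Finset.smul_sum, smul_comm c] } : (Fin n → E) →ₗ[ℝ] (ℝ → E))

theorem mem_polyCurves {n : ℕ} {x : ℝ → E} :
    x ∈ polyCurves E n ↔
      ∃ p : ℕ → E, ∀ s, x s = ∑ k ∈ Finset.range n, s ^ k • p k := by
  constructor
  · rintro ⟨p, rfl⟩
    refine ⟨fun k => if h : k < n then p ⟨k, h⟩ else 0, fun s => ?_⟩
    simp [Finset.sum_range]
  · rintro ⟨p, hp⟩
    refine ⟨fun k => p k, ?_⟩
    ext s
    simp [hp, Finset.sum_range]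

theorem pow_smul_mem_polyCurves {n k : ℕ} (hk : k < n) (v : E) :
    (fun s : ℝ => s ^ k • v) ∈ polyCurves E n :=
  mem_polyCurves.2 ⟨fun j => if j = k then v else 0, fun s => by simp [hk]⟩

theorem sum_mem_polyCurves (n : ℕ) (p : ℕ → E) :
    (fun s : ℝ => ∑ k ∈ Finset.range n, s ^ k • p k) ∈ polyCurves E n :=
  mem_polyCurves.2 ⟨p, fun _ => rfl⟩

theorem smul_id_mem_polyCurves {n : ℕ} {x : ℝ → E} (hx : x ∈ polyCurves E n) :
    (fun s => s • x s) ∈ polyCurves E (n + 1) := by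
  obtain ⟨p, hp⟩ := mem_polyCurves.1 hx
  refine mem_polyCurves.2 ⟨fun k => if k = 0 then 0 else p (k - 1), fun s => ?_⟩
  simp [hp, Finset.sum_range_succ', Finset.smul_sum, smul_smul, pow_succ']

theorem polyCurves_mono {m n : ℕ} (h : m ≤ n) : polyCurves E m ≤ polyCurves E n := by
  intro x hx
  obtain ⟨p, hp⟩ := mem_polyCurves.1 hx
  have : x = ∑ k ∈ Finset.range m, fun s : ℝ => s ^ k • p k := by
    ext s
    simp [hp]
  rw [this]
  exact Submodule.sum_mem _ fun k hk =>
    pow_smul_mem_polyCurves ((Finset.mem_range.1 hk).trans_le h) _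

theorem contDiff_of_mem_polyCurves {n : ℕ} {x : ℝ → E} (hx : x ∈ polyCurves E n)
    {m : WithTop ℕ∞} : ContDiff ℝ m x := by
  obtain ⟨p, hp⟩ := mem_polyCurves.1 hx
  rw [funext hp]
  fun_prop

theorem deriv_sum_pow_smul (n : ℕ) (p : ℕ → E) (s : ℝ) :
    deriv (fun r : ℝ => ∑ k ∈ Finset.range n, r ^ k • p k) s =
      ∑ k ∈ Finset.range n, ((k : ℝ) * s ^ (k - 1)) • p k :=
  (HasDerivAt.fun_sum fun k _ => (hasDerivAt_pow k s).smul_const (p k)).deriv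

theorem deriv_mem_polyCurves {n : ℕ} {x : ℝ → E} (hx : x ∈ polyCurves E (n + 1)) :
    deriv x ∈ polyCurves E n := by
  obtain ⟨p, hp⟩ := mem_polyCurves.1 hx
  refine mem_polyCurves.2 ⟨fun k => ((k : ℝ) + 1) • p (k + 1), fun s => ?_⟩
  rw [funext hp, deriv_sum_pow_smul, Finset.sum_range_succ']
  simp [smul_smul, mul_comm]

theorem iteratedDeriv_eq_zero_of_mem_polyCurves {n : ℕ} {x : ℝ → E}
    (hx : x ∈ polyCurves E n) : iteratedDeriv n x = 0 := by
  induction n generalizing x with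
  | zero =>
    obtain ⟨p, hp⟩ := mem_polyCurves.1 hx
    ext s
    simp [hp]
  | succ n ih =>
    rw [iteratedDeriv_succ']
    exact ih (deriv_mem_polyCurves hx)

theorem mem_polyCurves_of_iteratedDeriv_eq_zero {n : ℕ} {x : ℝ → E}
    (hx : ContDiff ℝ (⊤ : ℕ∞) x) (h : iteratedDeriv n x = 0) : x ∈ polyCurves E n := by
  induction n generalizing x with
  | zero =>
    rw [iteratedDeriv_zero] at h
    exact h ▸ Submodule.zero_mem _
  | succ n ih =>
    rw [iteratedDeriv_succ'] at h
    obtain ⟨p, hp⟩ := mem_polyCurves.1 (ih ((contDiff_infty_iff_deriv.1 hx).2) h)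
    let P : ℕ → E := fun k => if k = 0 then 0 else (k : ℝ)⁻¹ • p (k - 1)
    have hd : Differentiable ℝ (fun r : ℝ => ∑ k ∈ Finset.range (n + 1), r ^ k • P k) := by
      fun_prop
    have hxd : Differentiable ℝ x := (contDiff_infty_iff_deriv.1 hx).1
    have hP : ∀ s, deriv (x - fun r : ℝ => ∑ k ∈ Finset.range (n + 1), r ^ k • P k) s = 0 := by
      intro s
      rw [deriv_sub (hxd s) (hd s), hp, deriv_sum_pow_smul, Finset.sum_range_succ',
        sub_eq_zero]
      simp only [P, Nat.cast_zero, zero_mul, zero_smul, add_zero, Nat.succ_ne_zero, if_false,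
        Nat.add_sub_cancel, smul_smul]
      refine Finset.sum_congr rfl fun k _ => ?_
      congr 1
      have : ((k + 1 : ℕ) : ℝ) ≠ 0 := by positivity
      field_simp
    have hc := is_const_of_deriv_eq_zero (hxd.sub hd) hP
    have : x = (fun s : ℝ => s ^ 0 • (x - fun r : ℝ => ∑ k ∈ Finset.range (n + 1), r ^ k • P k) 0)
        + fun r : ℝ => ∑ k ∈ Finset.range (n + 1), r ^ k • P k := by
      ext s
      simp only [Pi.add_apply, pow_zero, one_smul]
      rw [← hc s 0]
      simp
    rw [this]
    exact Submodule.add_mem _ (pow_smul_mem_polyCurves n.succ_pos _) (sum_mem_polyCurves _ _)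

theorem comp_add_const_mem_polyCurves {n : ℕ} {x : ℝ → E} (hx : x ∈ polyCurves E n) (τ : ℝ) :
    (fun s => x (s + τ)) ∈ polyCurves E n := by
  refine mem_polyCurves_of_iteratedDeriv_eq_zero
    ((contDiff_of_mem_polyCurves hx).comp (contDiff_id.add contDiff_const)) ?_
  rw [iteratedDeriv_comp_add_const, iteratedDeriv_eq_zero_of_mem_polyCurves hx]
  rfl

theorem sub_pow_smul_mem_polyCurves {n k : ℕ} (hk : k < n) (τ : ℝ) (v : E) :
    (fun s : ℝ => (s - τ) ^ k • v) ∈ polyCurves E n :=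
  comp_add_const_mem_polyCurves (pow_smul_mem_polyCurves hk v) (-τ)

/-- Derivatives of polynomial curves of degree `< n` with respect to a parameter are again
polynomial curves of degree `< n`. -/
theorem hasDerivAt_param_mem_polyCurves [FiniteDimensional ℝ E] {n : ℕ} {G : ℝ → ℝ → E}
    {G' : ℝ → E} (hG : ∀ a, G a ∈ polyCurves E n)
    (h : ∀ s, HasDerivAt (fun a => G a s) (G' s) 0) : G' ∈ polyCurves E n := by
  have : FiniteDimensional ℝ (polyCurves E n) := by
    unfold polyCurves
    infer_instance
  have hc : IsClosed (polyCurves E n : Set (ℝ → E)) := Submodule.closed_of_finiteDimensional _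
  refine hc.mem_of_tendsto (b := 𝓝[≠] (0 : ℝ)) (f := fun a : ℝ => a⁻¹ • (G a - G 0))
    (tendsto_pi_nhds.2 fun s => ?_)
    (Eventually.of_forall fun a =>
      Submodule.smul_mem _ _ (Submodule.sub_mem _ (hG a) (hG 0)))
  simpa using (h s).tendsto_slope_zero

/-- If a polynomial curve of degree `< m + r` has the form `s ^ m • q s` with `q` convergent at
`0`, then `q` is a polynomial curve of degree `< r` away from `0`. -/
theorem exists_eq_sum_of_pow_smul_mem_polyCurves {m r : ℕ} {y q : ℝ → E} {L : E}
    (hy : y ∈ polyCurves E (m + r)) (hq : ∀ s, s ≠ 0 → y s = s ^ m • q s)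
    (hL : Tendsto q (𝓝[≠] 0) (𝓝 L)) :
    ∃ p : ℕ → E, ∀ s, s ≠ 0 → q s = ∑ k ∈ Finset.range r, s ^ k • p k := by
  induction m generalizing y with
  | zero =>
    rw [zero_add] at hy
    obtain ⟨p, hp⟩ := mem_polyCurves.1 hy
    exact ⟨p, fun s hs => by rw [← hp, hq s hs]; simp⟩
  | succ m ih =>
    rw [add_right_comm] at hy
    obtain ⟨p, hp⟩ := mem_polyCurves.1 hy
    have h0 : Tendsto y (𝓝[≠] 0) (𝓝 (y 0)) :=
      ((contDiff_of_mem_polyCurves hy (m := 0)).continuous.tendsto 0).mono_left nhdsWithin_le_nhds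
    have h1 : Tendsto y (𝓝[≠] 0) (𝓝 ((0 : ℝ) ^ (m + 1) • L)) := by
      have hpow : Tendsto (fun s : ℝ => s ^ (m + 1)) (𝓝[≠] 0) (𝓝 ((0 : ℝ) ^ (m + 1))) :=
        ((continuous_pow (m + 1)).tendsto 0).mono_left nhdsWithin_le_nhds
      refine (hpow.smul hL).congr' ?_
      filter_upwards [self_mem_nhdsWithin] with s hs using (hq s hs).symm
    have hp0 : p 0 = 0 := by
      have := tendsto_nhds_unique h0 h1
      rw [hp, Finset.sum_range_succ'] at this
      simpa using this
    refine ih (sum_mem_polyCurves (m + r) fun k => p (k + 1)) fun s hs => ?_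
    have := hq s hs
    rw [hp, Finset.sum_range_succ', hp0, smul_zero, add_zero, pow_succ', mul_smul] at this
    simp only [pow_succ', mul_smul, ← Finset.smul_sum] at this
    exact smul_right_injective E hs this

theorem mem_polyCurves_of_pow_smul_mem {m r : ℕ} {q : ℝ → E} (hq : Continuous q)
    (h : (fun s => s ^ m • q s) ∈ polyCurves E (m + r)) : q ∈ polyCurves E r := by
  obtain ⟨p, hp⟩ := exists_eq_sum_of_pow_smul_mem_polyCurves h (fun _ _ => rfl)
    ((hq.tendsto 0).mono_left nhdsWithin_le_nhds)
  refine mem_polyCurves.2 ⟨p, fun s => ?_⟩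
  refine congrFun (Continuous.ext_on (dense_compl_singleton (0 : ℝ)) hq ?_ fun t ht => hp t ht) s
  fun_prop

/-- A polynomial curve of degree `< n` of the form `(s - τ) ^ n • q s`, with `q` convergent
at `τ`, vanishes. -/
theorem eq_zero_of_sub_pow_smul_mem_polyCurves {n : ℕ} {τ : ℝ} {y q : ℝ → E} {L : E}
    (hy : y ∈ polyCurves E n) (hq : ∀ s, s ≠ 0 → y (s + τ) = s ^ n • q s)
    (hL : Tendsto q (𝓝[≠] 0) (𝓝 L)) : (∀ s, s ≠ 0 → q s = 0) ∧ L = 0 := by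
  obtain ⟨p, hp⟩ := exists_eq_sum_of_pow_smul_mem_polyCurves (r := 0)
    (comp_add_const_mem_polyCurves hy τ) hq hL
  have hp' : ∀ s, s ≠ 0 → q s = 0 := fun s hs => by simpa using hp s hs
  refine ⟨hp', tendsto_nhds_unique hL (tendsto_const_nhds.congr' ?_)⟩
  filter_upwards [self_mem_nhdsWithin] with s hs using (hp' s hs).symm

end PolynomialCurves

section Symmetries

variable {E F : Type*} [NormedAddCommGroup E] [NormedSpace ℝ E]
  [NormedAddCommGroup F] [NormedSpace ℝ F]

theorem tendsto_inv_pow_smul_sub {g : ℝ × E → F} (hg : ContDiff ℝ 1 g) (τ : ℝ) (x v : E)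
    {j : ℕ} (hj : j ≠ 0) :
    Tendsto (fun s : ℝ => (s ^ j)⁻¹ • (g (s + τ, x + s ^ j • v) - g (s + τ, x)))
      (𝓝[≠] 0) (𝓝 (fderiv ℝ g (τ, x) (0, v))) := by
  have hs : HasStrictFDerivAt g (fderiv ℝ g (τ, x)) (τ, x) :=
    hg.contDiffAt.hasStrictFDerivAt one_ne_zero
  have ht : Tendsto (fun s : ℝ => ((s + τ, x + s ^ j • v), (s + τ, x))) (𝓝[≠] 0)
      (𝓝 ((τ, x), (τ, x))) := by
    have hc : Continuous (fun s : ℝ => ((s + τ, x + s ^ j • v), (s + τ, x))) := by fun_prop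
    have := hc.tendsto 0
    simp only [zero_add, zero_pow hj, zero_smul, add_zero] at this
    exact this.mono_left nhdsWithin_le_nhds
  have ho := hs.isLittleO.comp_tendsto ht
  have ho' : (fun s : ℝ => g (s + τ, x + s ^ j • v) - g (s + τ, x)
      - s ^ j • fderiv ℝ g (τ, x) (0, v)) =o[𝓝[≠] 0] fun s : ℝ => s ^ j := by
    refine (ho.congr_left fun s => ?_).trans_isBigO ?_
    · have : ((s + τ, x + s ^ j • v) - (s + τ, x) : ℝ × E) = s ^ j • (0, v) := by
        simp
      simp only [Function.comp_apply, this, map_smul]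
    · refine Asymptotics.IsBigO.of_bound ‖v‖ (Eventually.of_forall fun s => ?_)
      simp [Prod.norm_def, norm_smul, mul_comm]
      positivity
  have hz := ho'.tendsto_inv_smul_nhds_zero
  refine ((hz.add_const (fderiv ℝ g (τ, x) (0, v))).congr' ?_).trans (by simp)
  filter_upwards [self_mem_nhdsWithin] with s hs
  rw [smul_sub, inv_smul_smul₀ (pow_ne_zero j hs), sub_add_cancel]

/-- A function whose partial derivative in the second variable is a fixed linear map `A`. -/
theorem eq_add_of_fderiv_inr_eq {g : ℝ × E → F} (hg : Differentiable ℝ g) {t : ℝ} {A : E →L[ℝ] F}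
    (h : ∀ x v, fderiv ℝ g (t, x) (0, v) = A v) (x : E) : g (t, x) = g (t, 0) + A x := by
  have hd : ∀ x, HasFDerivAt (fun x => g (t, x) - A x) (0 : E →L[ℝ] F) x := by
    intro x
    have := ((hg (t, x)).hasFDerivAt.comp x (hasFDerivAt_prodMk_right t x)).sub A.hasFDerivAt
    refine this.congr_fderiv ?_
    ext v
    have hv : (fderiv ℝ g (t, x)) (0, v) = A v := h x v
    simp [hv]
  have := is_const_of_fderiv_eq_zero (fun x => (hd x).differentiableAt)
    (fun x => (hd x).fderiv) x 0
  simp only [map_zero, sub_zero] at this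
  rw [← this, sub_add_cancel]

variable {n : ℕ} {ξ : ℝ × E → E} {f : ℝ × E → ℝ}

/-- The pair `(ξ, f)` maps polynomial curves of degree `< n` to such curves. -/
def PreservesPolyCurves (n : ℕ) (ξ : ℝ × E → E) (f : ℝ × E → ℝ) : Prop :=
  ∀ x ∈ polyCurves E n, (fun s => ξ (s, x s) - f (s, x s) • deriv x s) ∈ polyCurves E n

theorem PreservesPolyCurves.linearization [FiniteDimensional ℝ E] (hξ : Differentiable ℝ ξ)
    (hf : Differentiable ℝ f) (H : PreservesPolyCurves n ξ f) {x y : ℝ → E}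
    (hx : x ∈ polyCurves E n) (hy : y ∈ polyCurves E n) :
    (fun s => fderiv ℝ ξ (s, x s) (0, y s) - (f (s, x s) • deriv y s
      + fderiv ℝ f (s, x s) (0, y s) • deriv x s)) ∈ polyCurves E n := by
  have hxd : Differentiable ℝ x := (contDiff_of_mem_polyCurves hx (m := 1)).differentiable one_ne_zero
  have hyd : Differentiable ℝ y := (contDiff_of_mem_polyCurves hy (m := 1)).differentiable one_ne_zero
  refine hasDerivAt_param_mem_polyCurves
    (fun a : ℝ => H _ (Submodule.add_mem _ hx (Submodule.smul_mem _ a hy))) fun s => ?_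
  have hcurve : HasDerivAt (fun a : ℝ => (s, (x + a • y) s)) ((0 : ℝ), y s) 0 := by
    refine (hasDerivAt_const _ _).prodMk ?_
    simpa using ((hasDerivAt_id (0 : ℝ)).smul_const (y s)).const_add (x s)
  have hder : ∀ a : ℝ, deriv (x + a • y) s = deriv x s + a • deriv y s := fun a => by
    rw [deriv_add (hxd s) ((hyd s).const_smul a), deriv_const_smul _ (hyd s)]
  have h0 : (x + (0 : ℝ) • y) s = x s := by simp
  have h1 : HasDerivAt (fun a : ℝ => ξ (s, (x + a • y) s)) (fderiv ℝ ξ (s, x s) (0, y s)) 0 := by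
    have := (hξ (s, (x + (0 : ℝ) • y) s)).hasFDerivAt.comp_hasDerivAt 0 hcurve
    rwa [h0] at this
  have h2 : HasDerivAt (fun a : ℝ => f (s, (x + a • y) s)) (fderiv ℝ f (s, x s) (0, y s)) 0 := by
    have := (hf (s, (x + (0 : ℝ) • y) s)).hasFDerivAt.comp_hasDerivAt 0 hcurve
    rwa [h0] at this
  have h3 : HasDerivAt (fun a : ℝ => deriv (x + a • y) s) (deriv y s) 0 := by
    simp only [hder]
    simpa using ((hasDerivAt_id (0 : ℝ)).smul_const (deriv y s)).const_add (deriv x s)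
  have := h1.sub (h2.smul h3)
  rw [h0, hder, zero_smul, add_zero] at this
  exact this

theorem hasDerivAt_sub_pow_smul (k : ℕ) (τ : ℝ) (v : E) (s : ℝ) :
    HasDerivAt (fun r : ℝ => (r - τ) ^ k • v) ((k * (s - τ) ^ (k - 1)) • v) s := by
  simpa using (((hasDerivAt_id s).sub_const τ).pow k).smul_const v

theorem PreservesPolyCurves.fderiv_inr_eq_zero [FiniteDimensional ℝ E] {N : ℕ}
    (hξ : ContDiff ℝ 2 ξ) (hf : ContDiff ℝ 1 f) (H : PreservesPolyCurves (N + 3) ξ f)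
    (τ : ℝ) (x v : E) : fderiv ℝ f (τ, x) (0, v) = 0 := by
  have hξd : Differentiable ℝ ξ := hξ.differentiable two_ne_zero
  have hfd : Differentiable ℝ f := hf.differentiable one_ne_zero
  have hconst : (fun _ : ℝ => x) ∈ polyCurves E (N + 3) := by
    simpa using pow_smul_mem_polyCurves (n := N + 3) (k := 0) (by omega) x
  have hcurve : (fun s : ℝ => x + (s - τ) ^ 2 • v) ∈ polyCurves E (N + 3) :=
    Submodule.add_mem _ hconst (sub_pow_smul_mem_polyCurves (by omega) τ v)
  have hdir : (fun s : ℝ => (s - τ) ^ (N + 2) • v) ∈ polyCurves E (N + 3) :=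
    sub_pow_smul_mem_polyCurves (by omega) τ v
  have hmem := Submodule.sub_mem _ (H.linearization hξd hfd hcurve hdir)
    (H.linearization hξd hfd hconst hdir)
  let Ξ : ℝ × E → E := fun p => fderiv ℝ ξ p (0, v)
  have hΞ : ContDiff ℝ 1 Ξ := (hξ.fderiv_right (m := 1) le_rfl).clm_apply contDiff_const
  have h1 := (tendsto_id.mono_left nhdsWithin_le_nhds).smul
    (tendsto_inv_pow_smul_sub hΞ τ x v two_ne_zero)
  have h2 := tendsto_inv_pow_smul_sub hf τ x v two_ne_zero
  have h3 : Tendsto (fun s : ℝ => fderiv ℝ f (s + τ, x + s ^ 2 • v) (0, v)) (𝓝[≠] 0)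
      (𝓝 (fderiv ℝ f (τ, x) (0, v))) := by
    have hc : Continuous (fun s : ℝ => fderiv ℝ f (s + τ, x + s ^ 2 • v) (0, v)) :=
      ((hf.continuous_fderiv one_ne_zero).comp (by fun_prop)).clm_apply continuous_const
    simpa using (hc.tendsto 0).mono_left nhdsWithin_le_nhds
  have hL := h1.sub (((h2.const_mul ((N : ℝ) + 2)).add (h3.const_mul 2)).smul_const v)
  have hlim := (eq_zero_of_sub_pow_smul_mem_polyCurves (τ := τ) hmem (fun s hs => ?_) hL).2
  · rw [zero_smul, zero_sub, neg_eq_zero, smul_eq_zero] at hlim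
    rcases hlim with h | rfl
    · have hN : (N : ℝ) + 2 + 2 ≠ 0 := by positivity
      rw [← add_mul] at h
      exact (mul_eq_zero.1 h).resolve_left hN
    · exact map_zero _
  · have hdx : deriv (fun r : ℝ => x + (r - τ) ^ 2 • v) (s + τ) = (2 * s) • v := by
      simpa using ((hasDerivAt_sub_pow_smul 2 τ v (s + τ)).const_add x).deriv
    have hdy : deriv (fun r : ℝ => (r - τ) ^ (N + 2) • v) (s + τ)
        = (((N : ℝ) + 2) * s ^ (N + 1)) • v := by
      simpa using (hasDerivAt_sub_pow_smul (N + 2) τ v (s + τ)).deriv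
    have hpair : ((0 : ℝ), s ^ (N + 2) • v) = s ^ (N + 2) • ((0 : ℝ), v) := by simp
    simp only [Pi.sub_apply, hdx, hdy, deriv_const, add_sub_cancel_right, hpair, map_smul, smul_zero,
      add_zero, Ξ, id, smul_eq_mul]
    match_scalars <;> field_simp <;> ring

theorem PreservesPolyCurves.fderiv_inr_eq [FiniteDimensional ℝ E] {N : ℕ}
    (hξ : ContDiff ℝ 2 ξ) (hf : ContDiff ℝ 1 f) (H : PreservesPolyCurves (N + 3) ξ f)
    (t : ℝ) (x v : E) : fderiv ℝ ξ (t, x) (0, v) = fderiv ℝ ξ (t, 0) (0, v) := by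
  have hξd : Differentiable ℝ ξ := hξ.differentiable two_ne_zero
  have hfd : Differentiable ℝ f := hf.differentiable one_ne_zero
  have hf0 : ∀ s (y w : E), fderiv ℝ f (s, y) (0, w) = 0 := H.fderiv_inr_eq_zero hξ hf
  have hft : ∀ s (y : E), f (s, y) = f (s, 0) := fun s y => by
    simpa using eq_add_of_fderiv_inr_eq hfd (A := 0) (fun y w => hf0 s y w) y
  have hcurve : (fun s : ℝ => (s - (t - 1)) ^ 1 • x) ∈ polyCurves E (N + 3) :=
    sub_pow_smul_mem_polyCurves (by omega) _ x
  have hdir : (fun s : ℝ => (s - (t - 1)) ^ (N + 2) • v) ∈ polyCurves E (N + 3) :=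
    sub_pow_smul_mem_polyCurves (by omega) _ v
  have hmem := Submodule.sub_mem _ (H.linearization hξd hfd hcurve hdir)
    (H.linearization hξd hfd (Submodule.zero_mem _) hdir)
  have hΞ : ContDiff ℝ 1 fun p : ℝ × E => fderiv ℝ ξ p (0, v) :=
    (hξ.fderiv_right (m := 1) le_rfl).clm_apply contDiff_const
  have hL := tendsto_inv_pow_smul_sub hΞ (t - 1) 0 x one_ne_zero
  have hq := (eq_zero_of_sub_pow_smul_mem_polyCurves (τ := t - 1) hmem (fun s hs => ?_) hL).1 1 one_ne_zero
  · simpa [sub_eq_zero] using hq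
  · have hpair : ((0 : ℝ), s ^ (N + 2) • v) = s ^ (N + 2) • ((0 : ℝ), v) := by simp
    simp only [Pi.sub_apply, Pi.zero_apply, hft _ (_ • _), hf0, zero_smul, add_zero,
      add_sub_cancel_right, hpair, map_smul, zero_add]
    match_scalars <;> field_simp <;> ring

/-- The structure of the pairs preserving polynomial curves of degree `< N + 3`. -/
theorem PreservesPolyCurves.exists_eq [FiniteDimensional ℝ E] [Nontrivial E] {N : ℕ}
    (hξ : ContDiff ℝ 2 ξ) (hf : ContDiff ℝ 1 f) (H : PreservesPolyCurves (N + 3) ξ f) :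
    ∃ (α : ℕ → ℝ) (c : ℕ → E) (A : E →L[ℝ] E), ∀ t x,
      f (t, x) = ∑ k ∈ Finset.range 3, t ^ k • α k ∧
      ξ (t, x) = (∑ k ∈ Finset.range (N + 3), t ^ k • c k) + A x
        + (t * ((N + 2) * α 2)) • x := by
  have hξd : Differentiable ℝ ξ := hξ.differentiable two_ne_zero
  have hfd : Differentiable ℝ f := hf.differentiable one_ne_zero
  have hf0 : ∀ s (y w : E), fderiv ℝ f (s, y) (0, w) = 0 := H.fderiv_inr_eq_zero hξ hf
  have hft : ∀ s (y : E), f (s, y) = f (s, 0) := fun s y => by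
    simpa using eq_add_of_fderiv_inr_eq hfd (A := 0) (fun y w => hf0 s y w) y
  let M : ℝ → E →L[ℝ] E := fun t => (fderiv ℝ ξ (t, 0)).comp (ContinuousLinearMap.inr ℝ ℝ E)
  have hM : ∀ t v, M t v = fderiv ℝ ξ (t, 0) (0, v) := fun t v => rfl
  have hMc : ∀ v, Continuous fun t => M t v := fun v =>
    ((hξ.continuous_fderiv two_ne_zero).comp (by fun_prop)).clm_apply continuous_const
  have hβc : Continuous fun t => f (t, 0) := hf.continuous.comp (by fun_prop)
  have hξt : ∀ t x, ξ (t, x) = ξ (t, 0) + M t x := fun t =>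
    eq_add_of_fderiv_inr_eq hξd (H.fderiv_inr_eq hξ hf t)
  have hlin : ∀ y ∈ polyCurves E (N + 3),
      (fun s => M s (y s) - f (s, 0) • deriv y s) ∈ polyCurves E (N + 3) := fun y hy => by
    simpa [hf0, hM] using H.linearization hξd hfd (Submodule.zero_mem _) hy
  have hpow : ∀ k < N + 3, ∀ v,
      (fun s => s ^ k • M s v - f (s, 0) • (k * s ^ (k - 1)) • v) ∈ polyCurves E (N + 3) := by
    intro k hk v
    have hd : ∀ s, deriv (fun r : ℝ => r ^ k • v) s = (k * s ^ (k - 1)) • v := fun s =>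
      ((hasDerivAt_pow k s).smul_const v).deriv
    simpa [hd] using hlin _ (pow_smul_mem_polyCurves hk v)
  have hβ : ∀ v : E, (fun s => f (s, 0) • v) ∈ polyCurves E 3 := by
    intro v
    refine mem_polyCurves_of_pow_smul_mem (m := N + 1) (hβc.smul continuous_const) ?_
    have := Submodule.sub_mem _ (smul_id_mem_polyCurves (hpow (N + 1) (by omega) v))
      (polyCurves_mono (Nat.le_succ _) (hpow (N + 2) (by omega) v))
    rw [show N + 1 + 3 = N + 3 + 1 by omega]
    convert this using 1
    ext s
    simp only [Pi.sub_apply, Nat.add_sub_cancel, Nat.reduceSubDiff]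
    push_cast
    match_scalars <;> ring
  obtain ⟨α, hα⟩ : ∃ α : ℕ → ℝ, ∀ s, f (s, 0) = ∑ k ∈ Finset.range 3, s ^ k • α k := by
    obtain ⟨v, hv⟩ := exists_ne (0 : E)
    obtain ⟨φ, hφ⟩ := SeparatingDual.exists_eq_one (R := ℝ) hv
    obtain ⟨p, hp⟩ := mem_polyCurves.1 (hβ v)
    refine ⟨fun k => φ (p k), fun s => ?_⟩
    simpa [hφ] using congrArg φ (hp s)
  have hMA : ∀ s v, M s v = M 0 v + (s * ((N + 2) * α 2)) • v := by
    intro s v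
    have hmem : (fun s => M s v - (s * ((N + 2) * α 2)) • v) ∈ polyCurves E 1 := by
      refine mem_polyCurves_of_pow_smul_mem (m := N + 2)
        ((hMc v).sub (by fun_prop)) ?_
      have := Submodule.add_mem _ (hpow (N + 2) (by omega) v) (Submodule.add_mem _
        (pow_smul_mem_polyCurves (n := N + 3) (k := N + 1) (by omega) (((N + 2) * α 0) • v))
        (pow_smul_mem_polyCurves (n := N + 3) (k := N + 2) (by omega) (((N + 2) * α 1) • v)))
      convert this using 1
      ext s
      simp only [Pi.add_apply, hα, Finset.sum_range_succ, Finset.sum_range_zero, smul_eq_mul,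
        Nat.reduceSubDiff]
      push_cast
      match_scalars <;> ring
    obtain ⟨p, hp⟩ := mem_polyCurves.1 hmem
    have h1 := (hp s).trans (by simpa using (hp 0).symm)
    rw [← h1, sub_add_cancel]
  have hξ0 : (fun s => ξ (s, 0)) ∈ polyCurves E (N + 3) := by
    simpa using H 0 (Submodule.zero_mem _)
  obtain ⟨c, hc⟩ := mem_polyCurves.1 hξ0
  exact ⟨α, c, M 0, fun t x => ⟨by rw [hft, hα], by rw [hξt, hc, hMA, add_assoc]⟩⟩

/-- Affine vector fields and projective reparametrizations preserve polynomial curves. -/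
theorem preservesPolyCurves_of_eq {N : ℕ} {α : ℕ → ℝ} {c : ℕ → E} {A : E →ₗ[ℝ] E}
    (hf : ∀ t x, f (t, x) = ∑ k ∈ Finset.range 3, t ^ k • α k)
    (hξ : ∀ t x, ξ (t, x) = (∑ k ∈ Finset.range (N + 3), t ^ k • c k) + A x
        + (t * ((N + 2) * α 2)) • x) :
    PreservesPolyCurves (N + 3) ξ f := by
  intro x hx
  obtain ⟨p, hp⟩ := mem_polyCurves.1 hx
  have hA : (fun s => A (x s)) ∈ polyCurves E (N + 3) :=
    mem_polyCurves.2 ⟨fun k => A (p k), fun s => by simp [hp]⟩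
  have hx' := deriv_mem_polyCurves hx
  have hproj : (fun s => s • (((N : ℝ) + 2) • x s - s • deriv x s)) ∈ polyCurves E (N + 3) := by
    have : (fun s => s • (((N : ℝ) + 2) • x s - s • deriv x s)) =
        ∑ k ∈ Finset.range (N + 3), fun s : ℝ => s ^ (k + 1) • ((N : ℝ) + 2 - k) • p k := by
      ext s
      rw [funext hp, deriv_sum_pow_smul, Finset.sum_apply, Finset.smul_sum, Finset.smul_sum,
        ← Finset.sum_sub_distrib, Finset.smul_sum]
      refine Finset.sum_congr rfl fun k _ => ?_
      rcases k with _ | k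
      · simp
      · simp only [Nat.add_sub_cancel]
        match_scalars
        ring
    rw [this, Finset.sum_range_succ]
    refine Submodule.add_mem _ (Submodule.sum_mem _ fun k hk =>
      pow_smul_mem_polyCurves (by simpa using hk) _) ?_
    convert Submodule.zero_mem _ using 1
    ext s
    simp
  have := Submodule.add_mem _ (Submodule.add_mem _ (sum_mem_polyCurves (N + 3) c) hA)
    (Submodule.sub_mem _ (Submodule.smul_mem _ (α 2) hproj) (Submodule.add_mem _
      (Submodule.smul_mem _ (α 0) (polyCurves_mono (Nat.le_succ _) hx'))
      (Submodule.smul_mem _ (α 1) (smul_id_mem_polyCurves hx'))))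
  convert this using 1
  ext s
  simp only [Pi.add_apply, Pi.sub_apply, Pi.smul_apply, hf, hξ, Finset.sum_range_succ _ 2,
    Finset.sum_range_succ _ 1, Finset.sum_range_succ _ 0, smul_eq_mul]
  generalize ∑ k ∈ Finset.range (N + 3), s ^ k • c k = S
  module

end Symmetries

theorem preservesPolyCurves_iff {E : Type*} [NormedAddCommGroup E] [NormedSpace ℝ E] {n : ℕ}
    (hn : n ≠ 0) {ξ : ℝ × E → E} {f : ℝ × E → ℝ}
    (hξ : ContDiff ℝ (⊤ : ℕ∞) ξ) (hf : ContDiff ℝ (⊤ : ℕ∞) f) :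
    PreservesPolyCurves n ξ f ↔ ∀ p : ℕ → E, ∀ t : ℝ,
        iteratedDeriv n
          (fun s => ξ (s, ∑ k ∈ Finset.range n, s ^ k • p k)
            - f (s, ∑ k ∈ Finset.range n, s ^ k • p k)
              • deriv (fun r => ∑ k ∈ Finset.range n, r ^ k • p k) s) t = 0 := by
  constructor
  · exact fun H p t =>
      congrFun (iteratedDeriv_eq_zero_of_mem_polyCurves (H _ (sum_mem_polyCurves n p))) t
  · intro H x hx
    obtain ⟨p, hp⟩ := mem_polyCurves.1 hx
    obtain ⟨n, rfl⟩ := Nat.exists_eq_succ_of_ne_zero hn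
    have hc : ContDiff ℝ (⊤ : ℕ∞) fun s => (s, x s) :=
      contDiff_id.prodMk (contDiff_of_mem_polyCurves hx)
    refine mem_polyCurves_of_iteratedDeriv_eq_zero ((hξ.comp hc).sub ((hf.comp hc).smul
      (contDiff_of_mem_polyCurves (deriv_mem_polyCurves hx)))) ?_
    rw [funext hp]
    exact funext (H p)

/-- Lie point symmetries of the equation `dⁿx/dtⁿ = 0` (`n ≥ 3`) in `d` spatial dimensions:
`(ξ, f)` is a symmetry iff `f(t,x) = α₀ + α₁ t + α₂ t²` and
`ξ(t,x) = a + A x + t (b + (n−1) α₂ x) + Σ_{k=2}^{n−1} t^k c_k`. -/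
theorem lie_symmetries_of_higher_order_zero_motion (d n : ℕ) (hd : 1 ≤ d) (hn : 3 ≤ n)
    (ξ : ℝ × EuclideanSpace ℝ (Fin d) → EuclideanSpace ℝ (Fin d))
    (f : ℝ × EuclideanSpace ℝ (Fin d) → ℝ)
    (hξ : ContDiff ℝ (⊤ : ℕ∞) ξ) (hf : ContDiff ℝ (⊤ : ℕ∞) f) :
    (∀ p : ℕ → EuclideanSpace ℝ (Fin d), ∀ t : ℝ,
        iteratedDeriv n
          (fun s => ξ (s, ∑ k ∈ Finset.range n, s ^ k • p k)
            - f (s, ∑ k ∈ Finset.range n, s ^ k • p k)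
              • deriv (fun r => ∑ k ∈ Finset.range n, r ^ k • p k) s) t = 0)
    ↔ ∃ (α₀ α₁ α₂ : ℝ) (a b : EuclideanSpace ℝ (Fin d)) (c : ℕ → EuclideanSpace ℝ (Fin d))
        (A : EuclideanSpace ℝ (Fin d) →ₗ[ℝ] EuclideanSpace ℝ (Fin d)),
        ∀ (t : ℝ) (x : EuclideanSpace ℝ (Fin d)),
          f (t, x) = α₀ + α₁ * t + α₂ * t ^ 2 ∧
          ξ (t, x) = a + A x + t • (b + (((n : ℝ) - 1) * α₂) • x)
            + ∑ k ∈ Finset.Icc 2 (n - 1), t ^ k • c k := by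
  have : Nonempty (Fin d) := ⟨⟨0, hd⟩⟩
  rw [← preservesPolyCurves_iff (by omega) hξ hf]
  obtain ⟨N, rfl⟩ := Nat.exists_eq_add_of_le' hn
  have hN : ((N + 3 : ℕ) : ℝ) - 1 = N + 2 := by
    push_cast
    ring
  have hsum : ∀ (t : ℝ) (c : ℕ → EuclideanSpace ℝ (Fin d)),
      ∑ k ∈ Finset.range (N + 3), t ^ k • c k
        = c 0 + t • c 1 + ∑ k ∈ Finset.Icc 2 (N + 3 - 1), t ^ k • c k := by
    intro t c
    have hIcc : Finset.Icc 2 (N + 3 - 1) = Finset.Ico 2 (N + 3) := by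
      ext k
      simp only [Finset.mem_Icc, Finset.mem_Ico]
      omega
    rw [hIcc, ← Finset.sum_range_add_sum_Ico _ (show 2 ≤ N + 3 by omega)]
    simp [Finset.sum_range_succ]
  constructor
  · intro H
    obtain ⟨α, c, A, h⟩ := H.exists_eq (contDiff_infty.1 hξ 2) (contDiff_infty.1 hf 1)
    refine ⟨α 0, α 1, α 2, c 0, c 1, c, A, fun t x => ⟨?_, ?_⟩⟩
    · rw [(h t x).1]
      simp [Finset.sum_range_succ, mul_comm]
    · rw [(h t x).2, hsum, hN, ContinuousLinearMap.coe_coe]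
      module
  · rintro ⟨α₀, α₁, α₂, a, b, c, A, h⟩
    let α : ℕ → ℝ := fun k => if k = 0 then α₀ else if k = 1 then α₁ else α₂
    let C : ℕ → EuclideanSpace ℝ (Fin d) := fun k => if k = 0 then a else if k = 1 then b else c k
    refine preservesPolyCurves_of_eq (α := α) (c := C) (A := A) (fun t x => ?_) fun t x => ?_
    · rw [(h t x).1]
      simp [α, Finset.sum_range_succ, mul_comm]
    · have hC : ∑ k ∈ Finset.Icc 2 (N + 3 - 1), t ^ k • C k
          = ∑ k ∈ Finset.Icc 2 (N + 3 - 1), t ^ k • c k := by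
        refine Finset.sum_congr rfl fun k hk => ?_
        have := (Finset.mem_Icc.1 hk).1
        simp only [C, if_neg (show k ≠ 0 by omega), if_neg (show k ≠ 1 by omega)]
      rw [(h t x).2, hsum, hC, hN]
      simp only [C, α, if_true, one_ne_zero, if_false, two_ne_zero,
        if_neg (show (2 : ℕ) ≠ 1 by omega)]
      module
end
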